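/- arXiv:2111.06846 — 2 statements merged into one kernel-verified Lean document; each statement's English description precedes it below -/
import Mathlib

section
/- Let K ∈ L¹(ℝ) ∩ L²(ℝ) be symmetric with ∫|z||K(z)|dz < ∞, and suppose its Fourier transform K̂ belongs to L¹(ℝ) and K̂(t) = 1 for all |t| ≤ 1. Let μ_H be any probability measure on ℝ, σ > 0, and let F_X be the distribution function of μ_X = μ_H ∗ N(0,σ²) (Gaussian location mixture). Given h > 0 and α > 0, if σ ≥ √2 h ((2α+1)|log h|)^{1/2} (and h is small), then ∫_ℝ |(F_X ∗ K_h)(x) − F_X(x)| dx ≤ C h^{α+1}, with C independent of μ_H. -/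
open MeasureTheory Real Set Complex ProbabilityTheory

theorem aux_cutoff : ∃ (w w1 w2 : ℝ → ℝ) (B : ℝ), 0 < B ∧
    (∀ s, HasDerivAt w (w1 s) s) ∧ (∀ s, HasDerivAt w1 (w2 s) s) ∧ Measurable w2 ∧
    (∀ s, |w s| ≤ B) ∧ (∀ s, |w1 s| ≤ B) ∧ (∀ s, |w2 s| ≤ B) ∧
    (∀ s, |s| < 9/10 → w s = 0 ∧ w1 s = 0 ∧ w2 s = 0) ∧
    (∀ s, 1 ≤ |s| → s * w s = 1) ∧ (∀ s, |s * w s| ≤ 1) := by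
  let χ : ContDiffBump (0:ℝ) := ⟨9/10, 1, by norm_num, by norm_num⟩
  have hχ : ContDiff ℝ 3 χ := χ.contDiff
  have hχ1 : ContDiff ℝ 2 (deriv χ) := by
    have : ContDiff ℝ (2+1) χ := by norm_num; exact hχ
    exact (contDiff_succ_iff_deriv.1 this).2.2
  have hχ2 : ContDiff ℝ 1 (deriv (deriv χ)) := by
    have : ContDiff ℝ (1+1) (deriv χ) := by norm_num; exact hχ1
    exact (contDiff_succ_iff_deriv.1 this).2.2
  have hd0 : ∀ s, HasDerivAt χ (deriv χ s) s := fun s =>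
    ((hχ.differentiable (by norm_num)) s).hasDerivAt
  have hd1 : ∀ s, HasDerivAt (deriv χ) (deriv (deriv χ) s) s := fun s =>
    ((hχ1.differentiable (by norm_num)) s).hasDerivAt
  have hc : HasCompactSupport χ := χ.hasCompactSupport
  obtain ⟨B1, hB1⟩ := hc.deriv.exists_bound_of_continuous hχ1.continuous
  obtain ⟨B2, hB2⟩ := hc.deriv.deriv.exists_bound_of_continuous hχ2.continuous
  have hB1p : 0 ≤ B1 := le_trans (norm_nonneg _) (hB1 0)
  have hB2p : 0 ≤ B2 := le_trans (norm_nonneg _) (hB2 0)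
  have hone : ∀ s : ℝ, |s| < 9/10 → (χ =ᶠ[nhds s] fun _ => 1) := by
    intro s hs
    have : Metric.ball (0:ℝ) (9/10) ∈ nhds s :=
      Metric.isOpen_ball.mem_nhds (by simpa using hs)
    filter_upwards [this] with t ht
    exact χ.one_of_mem_closedBall (Metric.ball_subset_closedBall ht)
  have hD1 : ∀ s : ℝ, |s| < 9/10 → deriv χ s = 0 := fun s hs => by
    rw [(hone s hs).deriv_eq]; simp
  have hD1e : ∀ s : ℝ, |s| < 9/10 → (deriv χ =ᶠ[nhds s] fun _ => 0) := by
    intro s hs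
    have : Metric.ball (0:ℝ) (9/10) ∈ nhds s :=
      Metric.isOpen_ball.mem_nhds (by simpa using hs)
    filter_upwards [this] with t ht
    exact hD1 t (by simpa using ht)
  have hD2 : ∀ s : ℝ, |s| < 9/10 → deriv (deriv χ) s = 0 := fun s hs => by
    rw [(hD1e s hs).deriv_eq]; simp
  have hinv : ∀ s : ℝ, ¬ |s| < 9/10 → |s⁻¹| ≤ 2 := by
    intro s hs
    rw [abs_inv]
    push Not at hs
    calc |s|⁻¹ ≤ (9/10:ℝ)⁻¹ := inv_anti₀ (by norm_num) hs
      _ ≤ 2 := by norm_num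
  have hcabs : ∀ s, |1 - χ s| ≤ 1 := fun s => by
    rw [abs_le]; constructor <;> linarith [χ.nonneg (x := s), χ.le_one (x := s)]
  let w : ℝ → ℝ := fun s => (1 - χ s) * s⁻¹
  let w1 : ℝ → ℝ := fun s => - deriv χ s * s⁻¹ - (1 - χ s) * (s⁻¹)^2
  let w2 : ℝ → ℝ := fun s => - deriv (deriv χ) s * s⁻¹ + 2 * deriv χ s * (s⁻¹)^2
    + 2 * (1 - χ s) * (s⁻¹)^3
  have hz : ∀ s, |s| < 9/10 → w s = 0 ∧ w1 s = 0 ∧ w2 s = 0 := by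
    intro s hs
    simp [w, w1, w2, hD1 s hs, hD2 s hs, (hone s hs).eq_of_nhds]
  have hball : ∀ᶠ s in nhds (0:ℝ), |s| < 9/10 := by
    have : Metric.ball (0:ℝ) (9/10) ∈ nhds (0:ℝ) := Metric.ball_mem_nhds _ (by norm_num)
    filter_upwards [this] with t ht
    simpa using ht
  refine ⟨w, w1, w2, 1 + 2 * B2 + 8 * B1 + 16, by positivity, ?_, ?_, ?_, ?_, ?_, ?_, hz, ?_, ?_⟩
  · intro s
    by_cases hs : s = 0
    · subst hs
      rw [(hz 0 (by norm_num)).2.1]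
      refine (hasDerivAt_const (0:ℝ) (0:ℝ)).congr_of_eventuallyEq ?_
      filter_upwards [hball] with t ht using (hz t ht).1
    · refine (((hd0 s).const_sub 1).mul (hasDerivAt_inv hs)).congr_deriv ?_
      simp only [w1]; field_simp; ring
  · intro s
    by_cases hs : s = 0
    · subst hs
      rw [(hz 0 (by norm_num)).2.2]
      refine (hasDerivAt_const (0:ℝ) (0:ℝ)).congr_of_eventuallyEq ?_
      filter_upwards [hball] with t ht using (hz t ht).2.1
    · refine ((((hd1 s).neg).mul (hasDerivAt_inv hs)).sub
        (((hd0 s).const_sub 1).mul ((hasDerivAt_inv hs).pow 2))).congr_deriv ?_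
      simp only [w2]; simp; field_simp; ring
  · have h0 := hχ.continuous.measurable
    have h1 := hχ1.continuous.measurable
    have h2 := hχ2.continuous.measurable
    simp only [w2]
    fun_prop
  · intro s
    by_cases hs : |s| < 9/10
    · rw [(hz s hs).1]; simp; positivity
    · simp only [w, abs_mul]
      have := mul_le_mul (hcabs s) (hinv s hs) (abs_nonneg _) (by norm_num)
      linarith
  · intro s
    by_cases hs : |s| < 9/10
    · rw [(hz s hs).2.1]; simp; positivity
    · have a1 : |deriv χ s * s⁻¹| ≤ B1 * 2 := by
        rw [abs_mul]; exact mul_le_mul (hB1 s) (hinv s hs) (abs_nonneg _) hB1p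
      have a2 : |(1 - χ s) * (s⁻¹)^2| ≤ 1 * 2^2 := by
        rw [abs_mul, abs_pow]
        exact mul_le_mul (hcabs s) (pow_le_pow_left₀ (abs_nonneg _) (hinv s hs) 2) (by positivity) (by norm_num)
      rw [abs_le] at *
      simp only [w1]
      constructor <;> linarith [a1.1, a1.2, a2.1, a2.2]
  · intro s
    by_cases hs : |s| < 9/10
    · rw [(hz s hs).2.2]; simp; positivity
    · have a1 : |deriv (deriv χ) s * s⁻¹| ≤ B2 * 2 := by
        rw [abs_mul]; exact mul_le_mul (hB2 s) (hinv s hs) (abs_nonneg _) hB2p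
      have a2 : |deriv χ s * (s⁻¹)^2| ≤ B1 * 2^2 := by
        rw [abs_mul, abs_pow]
        exact mul_le_mul (hB1 s) (pow_le_pow_left₀ (abs_nonneg _) (hinv s hs) 2) (by positivity) hB1p
      have a3 : |(1 - χ s) * (s⁻¹)^3| ≤ 1 * 2^3 := by
        rw [abs_mul, abs_pow]
        exact mul_le_mul (hcabs s) (pow_le_pow_left₀ (abs_nonneg _) (hinv s hs) 3) (by positivity) (by norm_num)
      rw [abs_le] at *
      simp only [w2]
      constructor <;> linarith [a1.1, a1.2, a2.1, a2.2, a3.1, a3.2]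
  · intro s hs
    have : χ s = 0 := χ.zero_of_le_dist (by simpa using hs)
    have hs0 : s ≠ 0 := by rintro rfl; norm_num at hs
    simp [w, this, hs0]
  · intro s
    by_cases hs : s = 0
    · simp [hs]
    · have : s * w s = 1 - χ s := by simp only [w]; field_simp
      rw [this]; exact hcabs s

/-- Fourier inversion for the Gaussian density -/
theorem aux_gauss (β : ℝ) (hβ : 0 < β) (y : ℝ) :
    ∫ s : ℝ, Real.cos (s * y) * Real.exp (-β * s^2 / 2) =
      2 * π * gaussianPDFReal 0 (Real.toNNReal β) y := by
  have h := fourierIntegral_gaussian (b := ((β/2 : ℝ) : ℂ)) (by simpa using hβ) (y:ℂ)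
  have e1 : ∀ s : ℝ, cexp (I * y * s) * cexp (-((β/2 : ℝ) : ℂ) * s^2)
     = cexp (I * y * s + ((-β * s^2 / 2 : ℝ):ℂ)) := by
    intro s; rw [← Complex.exp_add]; congr 1; push_cast; ring
  have hinteg : Integrable (fun s : ℝ => cexp (I * y * s + ((-β * s^2 / 2 : ℝ):ℂ))) := by
    have := (integrable_exp_neg_mul_sq (b := β/2) (by positivity))
    refine Integrable.mono' this (by fun_prop) (Filter.Eventually.of_forall fun s => ?_)
    rw [Complex.norm_exp, Complex.add_re, Complex.ofReal_re]; simp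
    apply le_of_eq; ring
  simp_rw [e1] at h
  have h2 := congrArg Complex.re h
  have h3 := integral_re hinteg
  simp only [RCLike.re_eq_complex_re] at h3
  rw [← h3] at h2
  have e2 : ∀ s : ℝ, (cexp (I * y * s + ((-β * s^2 / 2 : ℝ):ℂ))).re
      = Real.cos (s * y) * Real.exp (-β * s^2 / 2) := by
    intro s
    rw [Complex.exp_re]
    have r : (I * y * s + ((-β * s^2 / 2 : ℝ):ℂ)).re = -β * s^2 / 2 := by
      rw [Complex.add_re, Complex.ofReal_re]; simp
    have i : (I * y * s + ((-β * s^2 / 2 : ℝ):ℂ)).im = s * y := by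
      rw [Complex.add_im, Complex.ofReal_im]; simp; ring
    rw [r, i]; ring
  simp_rw [e2] at h2
  rw [h2]
  have e3 : ((π:ℂ) / ((β/2:ℝ):ℂ)) ^ (1/2:ℂ) * cexp (-(y:ℂ)^2 / (4 * ((β/2:ℝ):ℂ)))
     = (((π/(β/2)) ^ (1/2:ℝ) * Real.exp (-y^2/(4*(β/2))) : ℝ) : ℂ) := by
    rw [Complex.ofReal_mul, Complex.ofReal_cpow (by positivity), Complex.ofReal_exp]
    push_cast; rfl
  rw [e3, Complex.ofReal_re, gaussianPDFReal_def]
  simp only [sub_zero, Real.coe_toNNReal _ hβ.le]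
  have e4 : (π/(β/2)) ^ (1/2:ℝ) = 2 * π * (√(2 * π * β))⁻¹ := by
    rw [← Real.sqrt_eq_rpow, ← div_eq_mul_inv, eq_div_iff (by positivity), ← Real.sqrt_mul (by positivity)]
    rw [Real.sqrt_eq_iff_mul_self_eq (by positivity) (by positivity)]
    field_simp
    try ring
  rw [e4]
  have e5 : -y^2/(4*(β/2)) = -y^2/(2*β) := by ring
  rw [e5]; ring

theorem aux_cdf (v : NNReal) (hv : v ≠ 0) :
    (∀ y, HasDerivAt (fun y => (gaussianReal 0 v (Iic y)).toReal) (gaussianPDFReal 0 v y) y) ∧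
    Filter.Tendsto (fun y => (gaussianReal 0 v (Iic y)).toReal) Filter.atBot (nhds 0) := by
  constructor
  · intro y
    have hi := integrable_gaussianPDFReal 0 v
    have e : (fun y => (gaussianReal 0 v (Iic y)).toReal) =
        fun y => (gaussianReal 0 v (Iic 0)).toReal + ∫ t in (0:ℝ)..y, gaussianPDFReal 0 v t := by
      funext y
      have hf : ∀ y, (gaussianReal 0 v (Iic y)).toReal = ∫ t in Iic y, gaussianPDFReal 0 v t := by
        intro y
        rw [gaussianReal_apply_eq_integral _ hv, ENNReal.toReal_ofReal]
        exact integral_nonneg fun _ => gaussianPDFReal_nonneg _ _ _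
      rw [hf, hf, ← intervalIntegral.integral_Iic_sub_Iic hi.integrableOn hi.integrableOn]
      ring
    rw [e]
    have hcont : Continuous (gaussianPDFReal 0 v) := by
      rw [gaussianPDFReal_def]; fun_prop
    exact (intervalIntegral.integral_hasDerivAt_right (hcont.intervalIntegrable _ _)
      (hcont.stronglyMeasurableAtFilter _ _) hcont.continuousAt).const_add _
  · have := tendsto_cdf_atBot (gaussianReal 0 v)
    refine this.congr fun y => ?_
    rw [cdf_eq_real]; rfl

theorem aux_pt (β s : ℝ) (hβ : 1 ≤ β) (hs : 9/10 ≤ |s|) :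
    Real.exp (-β * s^2 / 2) * (1 + 2 * β * |s| + β^2 * s^2 + β) ≤
      256 * Real.exp (-β/4) * Real.exp (-(1/20) * s^2) := by
  have hs2 : (81/100:ℝ) ≤ s^2 := by
    rw [← sq_abs]; nlinarith
  have hsq : s^2 = |s|^2 := (sq_abs s).symm
  set u := β * s^2 with hu
  have hub : 81/100 * β ≤ u := by nlinarith
  have hus : s^2 ≤ u := by nlinarith
  have h1 : β * |s| ≤ 2 * u := by
    have : |s| ≤ 2 * s^2 := by rw [hsq]; nlinarith
    calc β * |s| ≤ β * (2 * s^2) := by gcongr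
      _ = 2 * u := by rw [hu]; ring
  have h2 : β^2 * s^2 ≤ 2 * u^2 := by
    have : s^2 ≤ 2 * (s^2)^2 := by nlinarith
    calc β^2 * s^2 ≤ β^2 * (2 * (s^2)^2) := by gcongr
      _ = 2 * u^2 := by rw [hu]; ring
  have hu0 : 0 ≤ u := by linarith
  have h3 : 1 + 2 * β * |s| + β^2 * s^2 + β ≤ 256 * Real.exp (u/8) := by
    have := Real.quadratic_le_exp_of_nonneg (x := u/8) (by positivity)
    nlinarith
  calc Real.exp (-β * s^2 / 2) * (1 + 2 * β * |s| + β^2 * s^2 + β)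
      ≤ Real.exp (-β * s^2 / 2) * (256 * Real.exp (u/8)) := by gcongr
    _ = 256 * Real.exp (-(3/8) * u) := by
        rw [mul_left_comm, ← Real.exp_add]; congr 2; rw [hu]; ring
    _ ≤ 256 * Real.exp (-β/4 + -(1/20) * s^2) := by
        gcongr; linarith
    _ = _ := by rw [Real.exp_add]; ring

theorem aux_g : ∃ (A : ℝ) (χ : ℝ → ℝ), 0 < A ∧ Measurable χ ∧ (∀ s, |χ s| ≤ 2) ∧
    (∀ s, 1 ≤ |s| → χ s = 0) ∧ ∀ β : ℝ, 1 ≤ β → ∃ g : ℝ → ℝ,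
      (∀ y, |g y| ≤ A * Real.exp (-β/4) * (1 + y^2)⁻¹) ∧
      ∀ y, HasDerivAt g (gaussianPDFReal 0 (Real.toNNReal β) y -
        (2 * π)⁻¹ * ∫ s : ℝ, Real.cos (s * y) * (Real.exp (-β * s^2 / 2) * χ s)) y := by
  obtain ⟨w, w1, w2, B, hB, hw, hw1, hw2m, hwB, hw1B, hw2B, hz, h1, hs1⟩ := aux_cutoff
  have hwc : Continuous w := continuous_iff_continuousAt.2 fun s => (hw s).continuousAt
  have hw1c : Continuous w1 := continuous_iff_continuousAt.2 fun s => (hw1 s).continuousAt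
  have hwm := hwc.measurable
  have hw1m := hw1c.measurable
  have hI20 : Integrable (fun s : ℝ => Real.exp (-(1/20) * s^2)) :=
    integrable_exp_neg_mul_sq (by norm_num)
  set J := ∫ s : ℝ, Real.exp (-(1/20) * s^2) with hJ
  have hJ0 : 0 ≤ J := integral_nonneg fun s => (Real.exp_pos _).le
  refine ⟨512 * B * J + 1, fun s => 1 - s * w s, by positivity, by fun_prop, ?_, ?_, ?_⟩
  · intro s
    have := hs1 s
    rw [abs_le] at *
    constructor <;> linarith [this.1, this.2]
  · intro s hs; simp only; rw [h1 s hs]; ring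
  intro β hβ
  set E : ℝ → ℝ := fun s => Real.exp (-β * s^2 / 2) with hE
  have hEc : Continuous E := by simp only [hE]; fun_prop
  have hEm := hEc.measurable
  have hEd : ∀ s, HasDerivAt E (-β * s * E s) s := by
    intro s
    have : HasDerivAt (fun s : ℝ => -β * s^2 / 2) (-β * s) s := by
      refine (((hasDerivAt_pow 2 s).const_mul (-β)).div_const 2).congr_deriv ?_
      simp; ring
    refine this.exp.congr_deriv ?_
    simp only [hE]; ring
  have hE0 : ∀ s, 0 < E s := fun s => Real.exp_pos _
  have hEi : Integrable E := by
    have := (integrable_exp_neg_mul_sq (b := β/2) (by positivity))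
    refine this.congr (Filter.Eventually.of_forall fun s => ?_)
    simp only [hE]; congr 1; ring
  set M : ℝ → ℝ := fun s => E s * w s with hM
  set M1 : ℝ → ℝ := fun s => E s * (w1 s - β * s * w s) with hM1
  set M2 : ℝ → ℝ := fun s => E s * (w2 s - 2 * β * s * w1 s + (β^2 * s^2 - β) * w s) with hM2
  have hMd : ∀ s, HasDerivAt M (M1 s) s := by
    intro s
    refine ((hEd s).mul (hw s)).congr_deriv ?_
    simp only [hM1]; ring
  have hM1d : ∀ s, HasDerivAt M1 (M2 s) s := by
    intro s
    refine ((hEd s).mul ((hw1 s).sub (((hasDerivAt_id s).const_mul β).mul (hw s)))).congr_deriv ?_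
    simp only [hM2]; simp; ring
  set c := 256 * Real.exp (-β/4) with hc
  have hbd : ∀ (q s : ℝ), (|s| < 9/10 → q = 0) →
      |q| ≤ B * (1 + 2 * β * |s| + β^2 * s^2 + β) →
      |E s * q| ≤ B * c * Real.exp (-(1/20) * s^2) := by
    intro q s hq0 hq
    by_cases hs : |s| < 9/10
    · rw [hq0 hs]; simp; positivity
    · rw [abs_mul, abs_of_pos (hE0 s)]
      calc E s * |q| ≤ E s * (B * (1 + 2 * β * |s| + β^2 * s^2 + β)) := by
            gcongr
        _ = B * (E s * (1 + 2 * β * |s| + β^2 * s^2 + β)) := by ring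
        _ ≤ B * (c * Real.exp (-(1/20) * s^2)) := by
            exact mul_le_mul_of_nonneg_left (aux_pt β s hβ (not_lt.1 hs)) hB.le
        _ = _ := by ring
  have hMb : ∀ s, |M s| ≤ B * c * Real.exp (-(1/20) * s^2) := by
    intro s
    refine hbd _ s (fun h => (hz s h).1) ((hwB s).trans ?_)
    refine le_mul_of_one_le_right hB.le ?_
    have : 0 ≤ 2 * β * |s| + β^2 * s^2 + β := by positivity
    linarith
  have hM1b : ∀ s, |M1 s| ≤ B * c * Real.exp (-(1/20) * s^2) := by
    intro s
    refine hbd _ s (fun h => by simp [(hz s h).1, (hz s h).2.1]) ?_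
    calc |w1 s - β * s * w s| ≤ |w1 s| + |β * s * w s| := abs_sub _ _
      _ = |w1 s| + β * |s| * |w s| := by rw [abs_mul, abs_mul, abs_of_pos (by linarith : 0 < β)]
      _ ≤ B + β * |s| * B := by
          gcongr
          · exact hw1B s
          · exact hwB s
      _ = B * (1 + β * |s|) := by ring
      _ ≤ _ := by
          refine mul_le_mul_of_nonneg_left ?_ hB.le
          have : 0 ≤ β * |s| + β^2 * s^2 + β := by positivity
          linarith
  have hM2b : ∀ s, |M2 s| ≤ B * c * Real.exp (-(1/20) * s^2) := by
    intro s
    refine hbd _ s (fun h => by simp [(hz s h).1, (hz s h).2.1, (hz s h).2.2]) ?_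
    calc |w2 s - 2 * β * s * w1 s + (β^2 * s^2 - β) * w s|
        ≤ |w2 s| + |2 * β * s * w1 s| + |(β^2 * s^2 - β) * w s| :=
          (abs_add_le _ _).trans (by gcongr; exact abs_sub _ _)
      _ = |w2 s| + 2 * β * |s| * |w1 s| + |β^2 * s^2 - β| * |w s| := by
          rw [abs_mul (2 * β * s), abs_mul (2 * β), abs_mul _ (w s), abs_of_pos (by linarith : 0 < 2 * β)]
      _ ≤ B + 2 * β * |s| * B + (β^2 * s^2 + β) * B := by
          gcongr
          · exact hw2B s
          · exact hw1B s
          · rw [abs_le]; constructor <;> nlinarith [sq_nonneg (β * s)]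
          · exact hwB s
      _ = _ := by ring
  have hMi : ∀ f : ℝ → ℝ, Measurable f → (∀ s, |f s| ≤ B * c * Real.exp (-(1/20) * s^2)) →
      Integrable f ∧ ∫ s, |f s| ≤ B * c * J := by
    intro f hf hb
    have hfi : Integrable f := Integrable.mono' (hI20.const_mul (B*c)) hf.aestronglyMeasurable
      (Filter.Eventually.of_forall hb)
    refine ⟨hfi, ?_⟩
    rw [hJ, ← integral_const_mul]
    exact integral_mono hfi.abs (hI20.const_mul (B*c)) hb
  obtain ⟨hM_i, hM_J⟩ := hMi M (by simp only [hM]; fun_prop) hMb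
  obtain ⟨hM1_i, hM1_J⟩ := hMi M1 (by simp only [hM1]; fun_prop) hM1b
  obtain ⟨hM2_i, hM2_J⟩ := hMi M2 (by simp only [hM2]; fun_prop) hM2b
  have hcosi : ∀ (f : ℝ → ℝ) (y : ℝ), Integrable f →
      Integrable (fun s => Real.cos (s * y) * f s) := by
    intro f y hf
    refine hf.bdd_mul (c := 1) (by fun_prop) (Filter.Eventually.of_forall fun s => ?_)
    exact Real.abs_cos_le_one _
  have hsini : ∀ (f : ℝ → ℝ) (y : ℝ), Integrable f →
      Integrable (fun s => Real.sin (s * y) * f s) := by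
    intro f y hf
    refine hf.bdd_mul (c := 1) (by fun_prop) (Filter.Eventually.of_forall fun s => ?_)
    exact Real.abs_sin_le_one _
  have hsb : ∀ (f : ℝ → ℝ) (y : ℝ), Integrable f →
      |∫ s, Real.sin (s * y) * f s| ≤ ∫ s, |f s| := by
    intro f y hf
    refine (abs_integral_le_integral_abs).trans ?_
    refine integral_mono (hsini f y hf).abs hf.abs fun s => ?_
    simp only [abs_mul]
    exact mul_le_of_le_one_left (abs_nonneg _) (Real.abs_sin_le_one _)
  have hdsin : ∀ y s : ℝ, HasDerivAt (fun s => Real.sin (s * y)) (Real.cos (s*y) * y) s := by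
    intro y s
    simpa using ((hasDerivAt_id s).mul_const y).sin
  have hdcos : ∀ y s : ℝ, HasDerivAt (fun s => Real.cos (s * y)) (-Real.sin (s*y) * y) s := by
    intro y s
    simpa using ((hasDerivAt_id s).mul_const y).cos
  have hibp : ∀ y : ℝ, y^2 * ∫ s, Real.sin (s * y) * M s = - ∫ s, Real.sin (s * y) * M2 s := by
    intro y
    have p1 := integral_mul_deriv_eq_deriv_mul_of_integrable (u := fun s => Real.cos (s * y))
      (u' := fun s => -Real.sin (s*y) * y) (v := M) (v' := M1) (fun s _ => hdcos y s) (fun s _ => hMd s)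
      (hcosi M1 y hM1_i)
      (by
        refine ((hsini M y hM_i).const_mul (-y)).congr (Filter.Eventually.of_forall fun s => ?_)
        simp; ring) (hcosi M y hM_i)
    have p2 := integral_mul_deriv_eq_deriv_mul_of_integrable (u := fun s => Real.sin (s * y))
      (u' := fun s => Real.cos (s*y) * y) (v := M1) (v' := M2) (fun s _ => hdsin y s) (fun s _ => hM1d s)
      (hsini M2 y hM2_i)
      (by
        refine ((hcosi M1 y hM1_i).const_mul y).congr (Filter.Eventually.of_forall fun s => ?_)
        simp; ring) (hsini M1 y hM1_i)
    have q1 : ∫ s, (-Real.sin (s*y) * y) * M s = -y * ∫ s, Real.sin (s*y) * M s := by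
      rw [← integral_const_mul]; congr 1; funext s; ring
    have q2 : ∫ s, (Real.cos (s*y) * y) * M1 s = y * ∫ s, Real.cos (s*y) * M1 s := by
      rw [← integral_const_mul]; congr 1; funext s; ring
    rw [q1] at p1
    rw [q2, p1] at p2
    rw [p2]; ring
  refine ⟨fun y => (2*π)⁻¹ * ∫ s, Real.sin (s * y) * M s, ?_, ?_⟩
  · intro y
    have hpi : (2*π)⁻¹ ≤ 1 := inv_le_one_of_one_le₀ (by linarith [Real.pi_gt_three])
    have b1 := (hsb M y hM_i).trans hM_J
    have b2 := (hsb M2 y hM2_i).trans hM2_J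
    rw [← abs_neg, ← hibp, abs_mul, abs_of_nonneg (sq_nonneg y)] at b2
    rw [← div_eq_mul_inv, le_div_iff₀ (by positivity), abs_mul, abs_of_pos (by positivity)]
    have : |∫ s, Real.sin (s * y) * M s| * (1 + y^2) ≤ (512 * B * J + 1) * Real.exp (-β/4) := by
      have := Real.exp_pos (-β/4)
      simp only [hc] at b1 b2
      nlinarith
    calc _ = (2*π)⁻¹ * (|∫ s, Real.sin (s * y) * M s| * (1 + y^2)) := by ring
      _ ≤ 1 * (|∫ s, Real.sin (s * y) * M s| * (1 + y^2)) := by gcongr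
      _ ≤ _ := by rw [one_mul]; exact this
  · intro y
    have hswm : ∀ s, |s * M s| ≤ E s := by
      intro s
      have : s * M s = E s * (s * w s) := by simp only [hM]; ring
      rw [this, abs_mul, abs_of_pos (hE0 s)]
      exact mul_le_of_le_one_right (hE0 s).le (hs1 s)
    have hsMi : Integrable (fun s => s * M s) :=
      Integrable.mono' hEi (by simp only [hM]; fun_prop) (Filter.Eventually.of_forall hswm)
    have hder := (hasDerivAt_integral_of_dominated_loc_of_deriv_le (μ := volume)
      (F := fun y s => Real.sin (s * y) * M s) (F' := fun y s => Real.cos (s * y) * (s * M s))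
      (x₀ := y) (s := Set.univ) (bound := E) Filter.univ_mem
      (Filter.Eventually.of_forall fun y => (hsini M y hM_i).aestronglyMeasurable)
      (hsini M y hM_i) (hcosi _ y hsMi).aestronglyMeasurable
      (Filter.Eventually.of_forall fun s y _ => by
        rw [Real.norm_eq_abs, abs_mul]
        exact (mul_le_of_le_one_left (abs_nonneg _) (Real.abs_cos_le_one _)).trans (hswm s))
      hEi
      (Filter.Eventually.of_forall fun s y _ => by
        have : HasDerivAt (fun y => Real.sin (s * y)) (Real.cos (s*y) * s) y := by
          simpa using ((hasDerivAt_id y).const_mul s).sin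
        exact (this.mul_const (M s)).congr_deriv (by ring))).2
    refine (hder.const_mul (2*π)⁻¹).congr_deriv ?_
    have hg := aux_gauss β (by linarith) y
    have : ∀ s, Real.cos (s*y) * (s * M s) = Real.cos (s*y) * E s
        - Real.cos (s*y) * (E s * (1 - s * w s)) := by
      intro s; simp only [hM]; ring
    simp_rw [this]
    rw [integral_sub (hcosi E y hEi), hg]
    · rw [mul_sub, inv_mul_cancel_left₀ (by positivity)]
    · apply hcosi
      refine (hEi.sub hsMi).congr (Filter.Eventually.of_forall fun s => ?_)
      simp only [hM, Pi.sub_apply]; ring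

theorem aux_band (K : ℝ → ℝ) (hKmeas : Measurable K) (hKint : Integrable K)
    (hKhatOne : ∀ t : ℝ, |t| ≤ 1 → (∫ z : ℝ, Complex.exp (Complex.I * t * z) * K z) = 1)
    (F f e : ℝ → ℝ) (b : ℝ) (hFb : ∀ y, |F y| ≤ b)
    (hF0 : Filter.Tendsto F Filter.atBot (nhds 0))
    (he : Integrable e) (hem : Measurable e) (he1 : ∀ s, 1 ≤ |s| → e s = 0)
    (hf : ∀ y, f y = (2 * π)⁻¹ * ∫ s : ℝ, Real.cos (s * y) * e s)
    (hF : ∀ y, HasDerivAt F (f y) y) (y : ℝ) :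
    ∫ z, F (y - z) * K z = F y := by
  have hFc : Continuous F := continuous_iff_continuousAt.2 fun s => (hF s).continuousAt
  have hFm := hFc.measurable
  have hKc : ∀ t : ℝ, |t| ≤ 1 → (∫ z, Real.cos (t * z) * K z) = 1 ∧
      (∫ z, Real.sin (t * z) * K z) = 0 := by
    intro t ht
    have h := hKhatOne t ht
    have e1 : ∀ z : ℝ, Complex.exp (Complex.I * t * z) * K z =
        ((Real.cos (t*z) * K z : ℝ) : ℂ) + ((Real.sin (t*z) * K z : ℝ) : ℂ) * I := by
      intro z
      have : Complex.I * t * z = ((t * z : ℝ) : ℂ) * I := by push_cast; ring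
      rw [this, Complex.exp_mul_I, ← Complex.ofReal_cos, ← Complex.ofReal_sin]
      push_cast; ring
    have hci : Integrable (fun z => Real.cos (t*z) * K z) :=
      hKint.bdd_mul (c := 1) (by fun_prop)
        (Filter.Eventually.of_forall fun s => Real.abs_cos_le_one _)
    have hsi : Integrable (fun z => Real.sin (t*z) * K z) :=
      hKint.bdd_mul (c := 1) (by fun_prop)
        (Filter.Eventually.of_forall fun s => Real.abs_sin_le_one _)
    simp_rw [e1] at h
    have hci2 : Integrable (fun z => ((Real.cos (t*z) * K z : ℝ) : ℂ)) := hci.ofReal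
    have hsi2 : Integrable (fun z => ((Real.sin (t*z) * K z : ℝ) : ℂ)) := hsi.ofReal
    rw [integral_add hci2 (hsi2.mul_const I), integral_mul_const,
      integral_complex_ofReal, integral_complex_ofReal] at h
    constructor
    · have := congrArg Complex.re h; simpa using this
    · have := congrArg Complex.im h; simpa using this
  have hfc : ∀ y, f y = (2 * π)⁻¹ * ∫ s : ℝ, Real.cos (s * y) * e s := hf
  have hfb : ∀ y, |f y| ≤ (2*π)⁻¹ * ∫ s, |e s| := by
    intro y
    rw [hf, abs_mul, abs_of_pos (by positivity : (0:ℝ) < (2*π)⁻¹)]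
    gcongr
    refine abs_integral_le_integral_abs.trans ?_
    refine integral_mono_of_nonneg (Filter.Eventually.of_forall fun s => abs_nonneg _) he.abs
      (Filter.Eventually.of_forall fun s => ?_)
    simp only [abs_mul]
    exact mul_le_of_le_one_left (abs_nonneg _) (Real.abs_cos_le_one _)
  have hfm : Measurable f := by
    have : f = deriv F := funext fun y => (hF y).deriv.symm
    rw [this]; exact measurable_deriv F
  have hFKi : ∀ y, Integrable (fun z => F (y - z) * K z) := fun y =>
    hKint.bdd_mul (c := b) (by fun_prop) (Filter.Eventually.of_forall fun s => hFb _)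
  have hfKi : ∀ y, Integrable (fun z => f (y - z) * K z) := fun y =>
    hKint.bdd_mul (hfm.comp (measurable_const.sub measurable_id)).aestronglyMeasurable
      (Filter.Eventually.of_forall fun s => hfb _)
  -- the band-limited derivative is reproduced
  have hrep : ∀ y, ∫ z, f (y - z) * K z = f y := by
    intro y
    have hprod : Integrable (Function.uncurry fun z s : ℝ =>
        Real.cos (s * (y - z)) * (e s * K z)) (volume.prod volume) := by
      have h1 : Integrable (fun p : ℝ × ℝ => K p.1 * e p.2) (volume.prod volume) :=
        hKint.mul_prod he
      refine (h1.bdd_mul (c := 1) (f := fun p : ℝ × ℝ => Real.cos (p.2 * (y - p.1)))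
        (by fun_prop) (Filter.Eventually.of_forall fun s => Real.abs_cos_le_one _)).congr
        (Filter.Eventually.of_forall fun p => ?_)
      simp only [Function.uncurry]; ring
    calc ∫ z, f (y - z) * K z
        = ∫ z, (2*π)⁻¹ * ∫ s, Real.cos (s * (y - z)) * (e s * K z) := by
          congr 1; funext z
          rw [hf, mul_assoc, ← integral_mul_const]
          congr 2; funext s; ring
      _ = (2*π)⁻¹ * ∫ s, ∫ z, Real.cos (s * (y - z)) * (e s * K z) := by
          rw [integral_const_mul, integral_integral_swap hprod]
      _ = (2*π)⁻¹ * ∫ s, Real.cos (s * y) * e s := by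
          congr 2; funext s
          by_cases hs : 1 ≤ |s|
          · simp [he1 s hs]
          · obtain ⟨c1, c2⟩ := hKc s (le_of_lt (not_le.1 hs))
            have e2 : ∀ z, Real.cos (s * (y - z)) * (e s * K z) =
                (Real.cos (s*y) * e s) * (Real.cos (s*z) * K z) +
                (Real.sin (s*y) * e s) * (Real.sin (s*z) * K z) := by
              intro z
              rw [mul_sub, Real.cos_sub]; ring
            have hci : Integrable (fun z => Real.cos (s*z) * K z) :=
              hKint.bdd_mul (c := 1) (by fun_prop)
                (Filter.Eventually.of_forall fun s => Real.abs_cos_le_one _)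
            have hsi : Integrable (fun z => Real.sin (s*z) * K z) :=
              hKint.bdd_mul (c := 1) (by fun_prop)
                (Filter.Eventually.of_forall fun s => Real.abs_sin_le_one _)
            simp_rw [e2]
            rw [integral_add (hci.const_mul _) (hsi.const_mul _), integral_const_mul,
              integral_const_mul, c1, c2]
            ring
      _ = f y := (hf y).symm
  set D : ℝ → ℝ := fun y => (∫ z, F (y - z) * K z) - F y with hD
  have hDd : ∀ y, HasDerivAt D 0 y := by
    intro y
    have hder := (hasDerivAt_integral_of_dominated_loc_of_deriv_le (μ := volume)
      (F := fun y z => F (y - z) * K z) (F' := fun y z => f (y - z) * K z)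
      (x₀ := y) (s := Set.univ) (bound := fun z => ((2*π)⁻¹ * ∫ s, |e s|) * |K z|) Filter.univ_mem
      (Filter.Eventually.of_forall fun y => (hFKi y).aestronglyMeasurable)
      (hFKi y) (hfKi y).aestronglyMeasurable
      (Filter.Eventually.of_forall fun s y _ => by
        rw [Real.norm_eq_abs, abs_mul]
        exact mul_le_mul_of_nonneg_right (hfb _) (abs_nonneg _))
      (hKint.abs.const_mul _)
      (Filter.Eventually.of_forall fun z y _ => by
        have := (hF (y - z)).comp_sub_const y z
        exact this.mul_const (K z))).2
    refine (hder.sub (hF y)).congr_deriv ?_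
    rw [hrep]; ring
  have hDconst : ∀ x y, D x = D y := is_const_of_deriv_eq_zero
    (fun y => (hDd y).differentiableAt) (fun y => (hDd y).deriv)
  have hlim : Filter.Tendsto D Filter.atBot (nhds 0) := by
    have h1 : Filter.Tendsto (fun y => ∫ z, F (y - z) * K z) Filter.atBot
        (nhds (∫ z : ℝ, (0:ℝ))) := by
      refine tendsto_integral_filter_of_dominated_convergence (fun z => b * |K z|)
        (Filter.Eventually.of_forall fun y => (hFKi y).aestronglyMeasurable)
        (Filter.Eventually.of_forall fun y => Filter.Eventually.of_forall fun z => ?_)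
        (hKint.abs.const_mul _) (Filter.Eventually.of_forall fun z => ?_)
      · rw [Real.norm_eq_abs, abs_mul]
        exact mul_le_mul_of_nonneg_right (hFb _) (abs_nonneg _)
      · have : Filter.Tendsto (fun y : ℝ => y - z) Filter.atBot Filter.atBot :=
          Filter.tendsto_atBot_add_const_right _ (-z) Filter.tendsto_id
        simpa using (hF0.comp this).mul_const (K z)
    simpa using h1.sub hF0
  have : D y = 0 := by
    have h2 : D = fun _ => D y := funext fun x => hDconst x y
    rw [h2] at hlim
    exact tendsto_nhds_unique tendsto_const_nhds hlim
  simp only [hD] at this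
  linarith

theorem aux_bias (K : ℝ → ℝ) (hKmeas : Measurable K) (hKint : Integrable K)
    (hKhatOne : ∀ t : ℝ, |t| ≤ 1 → (∫ z : ℝ, Complex.exp (Complex.I * t * z) * K z) = 1) :
    ∃ C : ℝ, 0 < C ∧ ∀ β : ℝ, 1 ≤ β →
      ∫⁻ y : ℝ, ‖(∫ z, (gaussianReal 0 (Real.toNNReal β) (Iic (y - z))).toReal * K z)
        - (gaussianReal 0 (Real.toNNReal β) (Iic y)).toReal‖ₑ
        ≤ ENNReal.ofReal (C * Real.exp (-β/4)) := by
  obtain ⟨A, χ, hA, hχm, hχ2, hχ1, hg⟩ := aux_g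
  have hk0 : 0 ≤ ∫ z, |K z| := integral_nonneg fun _ => abs_nonneg _
  refine ⟨A * π * ((∫ z, |K z|) + 1), by positivity, fun β hβ => ?_⟩
  obtain ⟨g, hgb, hgd⟩ := hg β hβ
  have hv : Real.toNNReal β ≠ 0 := by
    rw [ne_eq, Real.toNNReal_eq_zero]; linarith
  obtain ⟨hGd, hG0⟩ := aux_cdf (Real.toNNReal β) hv
  set G : ℝ → ℝ := fun y => (gaussianReal 0 (Real.toNNReal β) (Iic y)).toReal with hG
  have hGc : Continuous G := continuous_iff_continuousAt.2 fun s => (hGd s).continuousAt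
  have hgc : Continuous g := continuous_iff_continuousAt.2 fun s => (hgd s).continuousAt
  have hGm := hGc.measurable
  have hgm := hgc.measurable
  have hGb : ∀ y, |G y| ≤ 1 := by
    intro y
    rw [abs_of_nonneg ENNReal.toReal_nonneg]
    exact ENNReal.toReal_le_of_le_ofReal (by norm_num) (by simpa using prob_le_one)
  set a := A * Real.exp (-β/4) with ha
  have ha0 : 0 < a := by positivity
  have hgb1 : ∀ y, |g y| ≤ a := by
    intro y
    refine (hgb y).trans (mul_le_of_le_one_right ha0.le ?_)
    exact inv_le_one_of_one_le₀ (by nlinarith [sq_nonneg y])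
  have hg0 : Filter.Tendsto g Filter.atBot (nhds 0) := by
    refine squeeze_zero_norm hgb ?_
    have : Filter.Tendsto (fun y : ℝ => (1 + y^2)⁻¹) Filter.atBot (nhds 0) := by
      refine Filter.Tendsto.inv_tendsto_atTop ?_
      refine Filter.tendsto_atTop_add_const_left _ _ ?_
      exact (Filter.Tendsto.comp (g := fun y : ℝ => y^2) (f := fun y : ℝ => -y)
        (Filter.tendsto_pow_atTop (by norm_num)) Filter.tendsto_neg_atBot_atTop).congr
          (fun y => by simp)
    simpa using this.const_mul a
  have hEi : Integrable (fun s : ℝ => Real.exp (-β * s^2 / 2)) := by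
    have := (integrable_exp_neg_mul_sq (b := β/2) (by positivity))
    refine this.congr (Filter.Eventually.of_forall fun s => ?_)
    simp only; congr 1; ring
  have hband := aux_band K hKmeas hKint hKhatOne (fun y => G y - g y)
    (fun y => (2 * π)⁻¹ * ∫ s : ℝ, Real.cos (s * y) * (Real.exp (-β * s^2 / 2) * χ s))
    (fun s => Real.exp (-β * s^2 / 2) * χ s) (1 + a)
    (fun y => (abs_sub _ _).trans (add_le_add (hGb y) (hgb1 y)))
    (by simpa using hG0.sub hg0)
    (hEi.mul_bdd (c := 2) hχm.aestronglyMeasurable (Filter.Eventually.of_forall hχ2))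
    (by fun_prop) (fun s hs => by simp [hχ1 s hs]) (fun y => rfl)
    (fun y => ((hGd y).sub (hgd y)).congr_deriv (by ring))
  have hGKi : ∀ y, Integrable (fun z => G (y - z) * K z) := fun y =>
    hKint.bdd_mul (c := 1) (by fun_prop) (Filter.Eventually.of_forall fun s => hGb _)
  have hgKi : ∀ y, Integrable (fun z => g (y - z) * K z) := fun y =>
    hKint.bdd_mul (c := a) (by fun_prop) (Filter.Eventually.of_forall fun s => hgb1 _)
  have hid : ∀ y, (∫ z, G (y - z) * K z) - G y = (∫ z, g (y - z) * K z) - g y := by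
    intro y
    have h := hband y
    simp only [sub_mul] at h
    rw [integral_sub (hGKi y) (hgKi y)] at h
    linarith
  have hgL : ∫⁻ y, ‖g y‖ₑ ≤ ENNReal.ofReal (a * π) := by
    have hi : Integrable (fun y : ℝ => a * (1 + y^2)⁻¹) := integrable_inv_one_add_sq.const_mul a
    calc ∫⁻ y, ‖g y‖ₑ ≤ ∫⁻ y, ENNReal.ofReal (a * (1 + y^2)⁻¹) := by
          refine lintegral_mono fun y => ?_
          rw [Real.enorm_eq_ofReal_abs]
          exact ENNReal.ofReal_le_ofReal (hgb y)
      _ = ENNReal.ofReal (a * π) := by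
          rw [← ofReal_integral_eq_lintegral_ofReal hi
            (Filter.Eventually.of_forall fun y => by simp only [Pi.zero_apply]; positivity), integral_const_mul,
            integral_univ_inv_one_add_sq]
  have hKL : ∫⁻ z, ‖K z‖ₑ = ENNReal.ofReal (∫ z, |K z|) := by
    rw [ofReal_integral_eq_lintegral_ofReal hKint.abs
      (Filter.Eventually.of_forall fun y => abs_nonneg _)]
    simp_rw [Real.enorm_eq_ofReal_abs]
  calc ∫⁻ y : ℝ, ‖(∫ z, G (y - z) * K z) - G y‖ₑ
      = ∫⁻ y : ℝ, ‖(∫ z, g (y - z) * K z) - g y‖ₑ := by simp_rw [hid]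
    _ ≤ ∫⁻ y : ℝ, ((∫⁻ z, ‖g (y - z)‖ₑ * ‖K z‖ₑ) + ‖g y‖ₑ) := by
        refine lintegral_mono fun y => (enorm_sub_le).trans ?_
        gcongr
        refine (enorm_integral_le_lintegral_enorm _).trans (le_of_eq ?_)
        simp_rw [enorm_mul]
    _ = (∫⁻ y : ℝ, ∫⁻ z, ‖g (y - z)‖ₑ * ‖K z‖ₑ) + ∫⁻ y, ‖g y‖ₑ := by
        rw [lintegral_add_right _ (by fun_prop)]
    _ = (∫⁻ z : ℝ, ∫⁻ y, ‖g (y - z)‖ₑ * ‖K z‖ₑ) + ∫⁻ y, ‖g y‖ₑ := by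
        rw [lintegral_lintegral_swap (by fun_prop)]
    _ = (∫⁻ y, ‖g y‖ₑ) * (∫⁻ z : ℝ, ‖K z‖ₑ) + ∫⁻ y, ‖g y‖ₑ := by
        congr 1
        rw [← lintegral_const_mul _ (by fun_prop)]
        congr 1; funext z
        rw [lintegral_mul_const _ (by fun_prop),
          lintegral_sub_right_eq_self (fun y => ‖g y‖ₑ) z]
    _ ≤ ENNReal.ofReal (a * π) * ENNReal.ofReal (∫ z, |K z|) + ENNReal.ofReal (a * π) := by
        rw [hKL]; gcongr
    _ = _ := by
        rw [← ENNReal.ofReal_mul (by positivity), ← ENNReal.ofReal_add (by positivity) (by positivity)]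
        congr 1; rw [ha]; ring

theorem aux_scale (h σ x : ℝ) (hh : 0 < h) (μH : Measure ℝ) [IsProbabilityMeasure μH] :
    (((μH.prod (gaussianReal 0 (Real.toNNReal (σ ^ 2)))).map
      (fun p : ℝ × ℝ => p.1 + p.2)) (Set.Iic x)).toReal =
    ∫ u, (gaussianReal 0 (Real.toNNReal (σ^2/h^2)) (Iic ((x - u)/h))).toReal ∂μH := by
  have hmap : gaussianReal 0 (Real.toNNReal (σ ^ 2)) =
      (gaussianReal 0 (Real.toNNReal (σ^2/h^2))).map (h * ·) := by
    rw [gaussianReal_map_const_mul]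
    congr 1
    · simp
    · apply NNReal.coe_injective
      rw [NNReal.coe_mul, Real.coe_toNNReal _ (by positivity), Real.coe_toNNReal _ (by positivity)]
      simp only [NNReal.coe_mk]
      field_simp
  have hm : Measurable (fun u => gaussianReal 0 (Real.toNNReal (σ^2/h^2)) (Iic ((x - u)/h))) := by
    have : Antitone (fun u => gaussianReal 0 (Real.toNNReal (σ^2/h^2)) (Iic ((x - u)/h))) := by
      intro u u' huu
      apply measure_mono
      apply Iic_subset_Iic.2
      gcongr
    exact this.measurable
  rw [Measure.map_apply (by fun_prop) measurableSet_Iic,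
    Measure.prod_apply ((by fun_prop : Measurable fun p : ℝ × ℝ => p.1 + p.2) measurableSet_Iic),
    integral_toReal hm.aemeasurable (Filter.Eventually.of_forall fun u => measure_lt_top _ _)]
  congr 2
  funext u
  rw [hmap, Measure.map_apply (by fun_prop)]
  · congr 1
    ext t
    simp only [mem_preimage, mem_Iic]
    rw [le_div_iff₀ hh]
    constructor <;> intro H <;> linarith
  · exact (by fun_prop : Measurable fun t : ℝ => u + t) measurableSet_Iic

/-- Bias bound for the distribution function of a Gaussian location mixture: let `K` be a
symmetric integrable and square-integrable kernel with `∫|z||K(z)|dz < ∞`, whose Fourier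
transform is integrable and equals `1` on `[−1,1]`. For any mixing probability measure
`μ_H` and `σ ≥ √2 h ((2α+1)|log h|)^{1/2}` (with `h` small), the distribution function
`F_X` of `μ_X = μ_H ∗ N(0,σ²)` satisfies `∫ |(F_X ∗ K_h)(x) − F_X(x)| dx ≤ C h^{α+1}`,
where `C` does not depend on `μ_H`, `h` or `σ`. -/
theorem stmt13 (K : ℝ → ℝ) (hKmeas : Measurable K) (hKint : Integrable K)
    (hKsq : Integrable (fun z => (K z) ^ 2)) (hKsymm : ∀ z, K (-z) = K z)
    (hKmom : Integrable (fun z => |z| * |K z|))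
    (hKhatInt : Integrable (fun t : ℝ => ∫ z : ℝ, Complex.exp (Complex.I * t * z) * K z))
    (hKhatOne : ∀ t : ℝ, |t| ≤ 1 → (∫ z : ℝ, Complex.exp (Complex.I * t * z) * K z) = 1)
    (α : ℝ) (hα : 0 < α) :
    ∃ C : ℝ, 0 < C ∧ ∃ h₀ : ℝ, 0 < h₀ ∧ h₀ < 1 ∧
      ∀ (μH : Measure ℝ), IsProbabilityMeasure μH →
      ∀ h σ : ℝ, 0 < h → h < h₀ → 0 < σ →
        Real.sqrt 2 * h * ((2 * α + 1) * |Real.log h|) ^ (1/2 : ℝ) ≤ σ →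
        (∫ x : ℝ,
          |(∫ z : ℝ,
              (((μH.prod (gaussianReal 0 (Real.toNNReal (σ ^ 2)))).map
                  (fun p : ℝ × ℝ => p.1 + p.2)) (Set.Iic (x - z))).toReal *
                ((1 / h) * K (z / h))) -
            (((μH.prod (gaussianReal 0 (Real.toNNReal (σ ^ 2)))).map
                (fun p : ℝ × ℝ => p.1 + p.2)) (Set.Iic x)).toReal|) ≤
          C * h ^ (α + 1) := by
  
  obtain ⟨C, hC, hbias⟩ := aux_bias K hKmeas hKint hKhatOne
  refine ⟨C, hC, Real.exp (-1), Real.exp_pos _, by simp, ?_⟩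
  intro μH hμ h σ hh hh0 hσ hσh
  have hlog : Real.log h < -1 := by
    rw [← Real.log_exp (-1)]; exact Real.log_lt_log hh hh0
  have hh1 : h < 1 := hh0.trans (by simp)
  have habs : |Real.log h| = - Real.log h := abs_of_neg (by linarith)
  set β := σ^2/h^2 with hβdef
  have hβ : 2 * ((2 * α + 1) * |Real.log h|) ≤ β := by
    rw [hβdef, le_div_iff₀ (by positivity)]
    have h1 := pow_le_pow_left₀ (by positivity) hσh 2
    rw [← Real.sqrt_eq_rpow, mul_pow, mul_pow, Real.sq_sqrt (by norm_num),
      Real.sq_sqrt (by positivity)] at h1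
    linarith
  have hβ1 : 1 ≤ β := by
    rw [habs] at hβ; nlinarith
  have hexp : Real.exp (-β/4) ≤ h ^ α := by
    rw [Real.rpow_def_of_pos hh]
    apply Real.exp_le_exp.2
    rw [habs] at hβ; nlinarith
  have hb := hbias β hβ1
  simp_rw [aux_scale h σ _ hh μH]
  rw [← hβdef]
  have hv : Real.toNNReal β ≠ 0 := by
    rw [ne_eq, Real.toNNReal_eq_zero]; linarith
  obtain ⟨hGd, -⟩ := aux_cdf (Real.toNNReal β) hv
  set G : ℝ → ℝ := fun y => (gaussianReal 0 (Real.toNNReal β) (Iic y)).toReal with hG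
  have hGc : Continuous G := continuous_iff_continuousAt.2 fun s => (hGd s).continuousAt
  have hGm := hGc.measurable
  have hGb : ∀ y, |G y| ≤ 1 := by
    intro y
    rw [abs_of_nonneg ENNReal.toReal_nonneg]
    exact ENNReal.toReal_le_of_le_ofReal (by norm_num) (by simpa using prob_le_one)
  set b : ℝ → ℝ := fun y => (∫ z, G (y - z) * K z) - G y with hbdef
  have hcm : Measurable (fun y => ∫ z, G (y - z) * K z) := by
    have : StronglyMeasurable (Function.uncurry fun y z : ℝ => G (y - z) * K z) := by
      apply Measurable.stronglyMeasurable
      simp only [Function.uncurry_def]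
      fun_prop
    exact this.integral_prod_right.measurable
  have hbm : Measurable b := hcm.sub hGm
  have hcb : ∀ y, |∫ z, G (y - z) * K z| ≤ ∫ z, |K z| := by
    intro y
    refine abs_integral_le_integral_abs.trans ?_
    refine integral_mono_of_nonneg (Filter.Eventually.of_forall fun s => abs_nonneg _) hKint.abs
      (Filter.Eventually.of_forall fun s => ?_)
    simp only [abs_mul]
    exact mul_le_of_le_one_left (abs_nonneg _) (hGb _)
  have key : ∀ x : ℝ, (∫ z : ℝ, (∫ u, G ((x - z - u)/h) ∂μH) * ((1 / h) * K (z / h))) -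
      (∫ u, G ((x - u)/h) ∂μH) = ∫ u, b ((x - u)/h) ∂μH := by
    intro x
    have hsub : (∫ z : ℝ, (∫ u, G ((x - z - u)/h) ∂μH) * ((1 / h) * K (z / h))) =
        ∫ z : ℝ, ∫ u, G ((x - u)/h - z) * K z ∂μH := by
      have h1 := Measure.integral_comp_div
        (fun z : ℝ => (∫ u, G ((x - h * z - u)/h) ∂μH) * ((1 / h) * K z)) h
      have e1 : ∀ z, h * (z / h) = z := fun z => by field_simp
      simp only [e1] at h1
      rw [h1, abs_of_pos hh, smul_eq_mul, ← integral_const_mul]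
      congr 1; funext z
      rw [integral_mul_const]
      have e2 : ∀ u, (x - h * z - u)/h = (x - u)/h - z := fun u => by field_simp; ring
      simp_rw [e2]
      field_simp
    have hprod : Integrable (Function.uncurry fun z u : ℝ => G ((x - u)/h - z) * K z)
        (volume.prod μH) := by
      have h1 : Integrable (fun p : ℝ × ℝ => K p.1) (volume.prod μH) := hKint.comp_fst μH
      exact h1.bdd_mul (c := 1) (f := fun p : ℝ × ℝ => G ((x - p.2)/h - p.1))
        (by fun_prop) (Filter.Eventually.of_forall fun s => hGb _)
    rw [hsub, integral_integral_swap hprod, ← integral_sub]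
    · refine Integrable.of_bound (C := ∫ z, |K z|)
        (hcm.comp (by fun_prop : Measurable fun u => (x - u)/h)).aestronglyMeasurable
        (Filter.Eventually.of_forall fun u => hcb _)
    · exact Integrable.of_bound (C := 1) (by fun_prop) (Filter.Eventually.of_forall fun u => hGb _)
  have hL : ∫⁻ x : ℝ, ‖∫ u, b ((x - u)/h) ∂μH‖ₑ ≤ ENNReal.ofReal (h * (C * Real.exp (-β/4))) := by
    have hscale : ∀ u : ℝ, ∫⁻ x, ‖b ((x - u)/h)‖ₑ = ENNReal.ofReal h * ∫⁻ y, ‖b y‖ₑ := by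
      intro u
      rw [lintegral_sub_right_eq_self (fun x => ‖b (x/h)‖ₑ) u]
      have hm := Real.map_volume_mul_left (a := h⁻¹) (by positivity)
      have h2 : ∫⁻ x, ‖b (x/h)‖ₑ = ∫⁻ y, ‖b y‖ₑ ∂(volume.map (h⁻¹ * ·)) := by
        rw [lintegral_map (by fun_prop) (by fun_prop)]
        congr 1; funext x; congr 2; field_simp
      rw [h2, hm, lintegral_smul_measure, inv_inv, abs_of_pos hh, smul_eq_mul]
    calc ∫⁻ x : ℝ, ‖∫ u, b ((x - u)/h) ∂μH‖ₑ
        ≤ ∫⁻ x : ℝ, ∫⁻ u, ‖b ((x - u)/h)‖ₑ ∂μH :=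
          lintegral_mono fun x => enorm_integral_le_lintegral_enorm _
      _ = ∫⁻ u, (∫⁻ x : ℝ, ‖b ((x - u)/h)‖ₑ) ∂μH := by
          rw [lintegral_lintegral_swap (by fun_prop)]
      _ = ENNReal.ofReal h * ∫⁻ y, ‖b y‖ₑ := by
          simp_rw [hscale]; simp
      _ ≤ ENNReal.ofReal h * ENNReal.ofReal (C * Real.exp (-β/4)) := by gcongr
      _ = _ := by rw [ENNReal.ofReal_mul hh.le]
  have hfin : ∫ x : ℝ, |∫ u, b ((x - u)/h) ∂μH| ≤ h * (C * Real.exp (-β/4)) := by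
    have h3 : ‖∫ x : ℝ, |∫ u, b ((x - u)/h) ∂μH|‖ₑ ≤ ENNReal.ofReal (h * (C * Real.exp (-β/4))) := by
      refine (enorm_integral_le_lintegral_enorm _).trans ?_
      simpa only [enorm_abs] using hL
    rw [Real.enorm_eq_ofReal_abs, ENNReal.ofReal_le_ofReal_iff (by positivity)] at h3
    exact (le_abs_self _).trans h3
  have hcongr : (fun x : ℝ => |(∫ z : ℝ, (∫ u, G ((x - z - u)/h) ∂μH) * ((1 / h) * K (z / h))) -
      (∫ u, G ((x - u)/h) ∂μH)|) = fun x => |∫ u, b ((x - u)/h) ∂μH| :=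
    funext fun x => by rw [key x]
  refine le_trans (le_of_eq (congrArg (fun f : ℝ → ℝ => ∫ x, f x) hcongr)) ?_
  refine hfin.trans ?_
  rw [Real.rpow_add hh, Real.rpow_one]
  calc h * (C * Real.exp (-β/4)) ≤ h * (C * h ^ α) := by gcongr
    _ = C * (h ^ α * h) := by ring
end

section
/- Let f₀X be a probability density on ℝ with ∫_ℝ |t|^α |f̂₀X(t)| dt < ∞ for some α > 0, and suppose the fractional derivative D^α f₀X(x) := (2π)^{−1} ∫ e^{−itx}(−it)^α f̂₀X(t) dt belongs to L¹(ℝ). Let K ∈ L¹(ℝ) ∩ L²(ℝ) be symmetric with ∫|z||K(z)|dz < ∞, K̂ ∈ L¹(ℝ), and K̂ ≡ 1 on [−1,1]. Then the distribution function F₀X of f₀X satisfies ∫_ℝ |(F₀X ∗ K_h)(x) − F₀X(x)| dx = O(h^{α+1}) as h → 0. -/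
open MeasureTheory Real Set Complex

open scoped FourierTransform SchwartzMap ContDiff

/-- The (unnormalised) Fourier integral `∫ e^{-itx} g(t) dt`. -/
noncomputable def Psi (g : ℝ → ℂ) (x : ℝ) : ℂ := ∫ t : ℝ, Complex.exp (-(Complex.I * t * x)) * g t

lemma fourier_eq_Psi (g : ℝ → ℂ) (w : ℝ) : 𝓕 g w = Psi g (2 * π * w) := by
  rw [Real.fourier_real_eq_integral_exp_smul, Psi]
  congr 1; ext v
  simp only [smul_eq_mul]
  congr 2
  push_cast; ring

lemma Psi_eq_fourier (g : ℝ → ℂ) (x : ℝ) : Psi g x = 𝓕 g ((2 * π)⁻¹ * x) := by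
  rw [fourier_eq_Psi]; congr 1; field_simp

lemma Psi_continuous {g : ℝ → ℂ} (hg : Integrable g) : Continuous (Psi g) := by
  unfold Psi
  apply continuous_of_dominated (bound := fun t => ‖g t‖)
  · intro x
    exact (by fun_prop : Continuous fun t : ℝ => Complex.exp (-(Complex.I * t * x))).aestronglyMeasurable.mul hg.1
  · intro x
    filter_upwards with t
    rw [norm_mul, Complex.norm_exp]; simp
  · exact hg.norm
  · filter_upwards with t
    fun_prop

lemma Psi_norm_le (g : ℝ → ℂ) (x : ℝ) : ‖Psi g x‖ ≤ ∫ t, ‖g t‖ := by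
  unfold Psi
  refine (norm_integral_le_integral_norm _).trans (le_of_eq ?_)
  congr 1; ext t
  rw [norm_mul, Complex.norm_exp]; simp

lemma fourier_flip {f g : ℝ → ℂ} (hf : Integrable f) (hg : Integrable g) :
    ∫ x, 𝓕 f x * g x = ∫ x, f x * 𝓕 g x := by
  simpa using! VectorFourier.integral_bilin_fourierIntegral_eq_flip (ContinuousLinearMap.mul ℂ ℂ)
    (L := innerₗ ℝ) continuous_fourierChar continuous_inner hf hg

lemma fourierInv_flip {f g : ℝ → ℂ} (hf : Integrable f) (hg : Integrable g) :
    ∫ x, 𝓕⁻ f x * g x = ∫ x, f x * 𝓕⁻ g x := by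
  have h := fourier_flip hf hg.comp_neg
  rw [← integral_neg_eq_self] at h
  simp only [neg_neg] at h
  convert h using 2
  · ext x; rw [Real.fourierInv_eq_fourier_neg]
  · ext x; rw [Real.fourierInv_eq_fourier_comp_neg]

/-- Test functions as Schwartz functions, complex valued. -/
noncomputable def tst (g : ℝ → ℝ) (hg : ContDiff ℝ ∞ g) (hs : HasCompactSupport g) : 𝓢(ℝ, ℂ) :=
  HasCompactSupport.toSchwartzMap (f := fun x => (g x : ℂ))
    (hs.comp_left (g := fun x : ℝ => (x : ℂ)) (by simp)) (Complex.ofRealCLM.contDiff.comp hg)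

lemma tst_apply (g : ℝ → ℝ) (hg : ContDiff ℝ ∞ g) (hs : HasCompactSupport g) (x : ℝ) :
    tst g hg hs x = g x := rfl

lemma fourier_inv_ae {f : ℝ → ℂ} (hf : Integrable f) (hf' : Integrable (𝓕 f)) :
    ∀ᵐ x, 𝓕⁻ (𝓕 f) x = f x := by
  have hc : Continuous (𝓕⁻ (𝓕 f)) := by
    have := Psi_continuous hf'
    have e : 𝓕⁻ (𝓕 f) = fun x => Psi (𝓕 f) (2 * π * (-x)) := by
      ext x; rw [Real.fourierInv_eq_fourier_neg, fourier_eq_Psi]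
    rw [e]; fun_prop
  refine ae_eq_of_integral_contDiff_smul_eq hc.locallyIntegrable hf.locallyIntegrable ?_
  intro g hg hs
  set φ := tst g hg hs
  have h1 : ∫ x, 𝓕⁻ (𝓕 f) x * φ x = ∫ x, 𝓕 f x * (𝓕⁻ φ) x := by
    rw [SchwartzMap.fourierInv_coe]
    exact fourierInv_flip hf' φ.integrable
  have h2 : ∫ x, 𝓕 f x * (𝓕⁻ φ) x = ∫ x, f x * (𝓕 (𝓕⁻ φ)) x := by
    rw [SchwartzMap.fourier_coe (𝓕⁻ φ)]
    exact fourier_flip hf (SchwartzMap.integrable _)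
  rw [FourierTransform.fourier_fourierInv_eq] at h2
  rw [h2] at h1
  simpa [mul_comm, φ, tst_apply] using h1

lemma Psi_Psi_ae {f : ℝ → ℂ} (hf : Integrable f) (hf' : Integrable (Psi f)) :
    ∀ᵐ x, Psi (Psi f) (-x) = 2 * π * f x := by
  have h1 : Integrable (𝓕 f) := by
    have := hf'.comp_mul_left' (R := 2 * π) (by positivity)
    refine this.congr ?_
    filter_upwards with x
    rw [fourier_eq_Psi]
  filter_upwards [fourier_inv_ae hf h1] with x hx
  rw [← hx, Real.fourierInv_eq_fourier_neg, Real.fourier_real_eq_integral_exp_smul, Psi]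
  have := Measure.integral_comp_mul_left (fun t : ℝ => Complex.exp (-(Complex.I * t * (-x : ℝ))) * Psi f t) (2 * π)
  rw [abs_of_pos (by positivity)] at this
  rw [eq_comm]
  calc _ = (2 * π : ℂ) * ∫ (y : ℝ), Complex.exp (-(Complex.I * ((2 * π * y : ℝ) : ℂ) * (-x : ℝ))) * Psi f (2 * π * y) := by
        congr 2; ext v; rw [fourier_eq_Psi, smul_eq_mul]; congr 2; push_cast; ring
    _ = _ := by
        rw [this, Complex.real_smul, ← mul_assoc]
        push_cast
        rw [mul_inv_cancel₀ (by norm_cast; positivity), one_mul]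

lemma plancherel_memLp {f : ℝ → ℂ} (hf : Integrable f) (hf2 : MemLp f 2) : MemLp (𝓕 f) 2 := by
  set H := 𝓕 (hf2.toLp f) with hH
  have hm := Lp.memLp H
  refine hm.ae_eq ?_
  have hc : Continuous (𝓕 f) := by
    have := Psi_continuous hf
    have e : 𝓕 f = fun x => Psi f (2 * π * x) := by
      ext x; rw [fourier_eq_Psi]
    rw [e]; fun_prop
  refine ae_eq_of_integral_contDiff_smul_eq (hm.locallyIntegrable (by norm_num)) hc.locallyIntegrable ?_
  intro g hg hs
  set φ := tst g hg hs
  have h1 := Lp.fourier_toTemperedDistribution_eq (hf2.toLp f)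
  have h2 := congrArg (fun T => T φ) h1
  simp only [TemperedDistribution.fourier_apply, Lp.toTemperedDistribution_apply] at h2
  have h3 : ∫ x, 𝓕 f x * φ x = ∫ x, f x * (𝓕 φ) x := by
    rw [SchwartzMap.fourier_coe φ]
    exact fourier_flip hf φ.integrable
  have h4 : ∫ x, (𝓕 φ) x • (hf2.toLp f) x = ∫ x, f x * (𝓕 φ) x := by
    apply integral_congr_ae
    filter_upwards [hf2.coeFn_toLp] with x hx
    rw [hx, smul_eq_mul, mul_comm]
  rw [h4, ← h3] at h2
  rw [← hH] at h2
  simpa [mul_comm, φ, tst_apply] using h2.symm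

lemma plancherel_Psi {f : ℝ → ℂ} (hf : Integrable f) (hf2 : MemLp f 2) : Integrable fun x => ‖Psi f x‖ ^ 2 := by
  have h := (plancherel_memLp hf hf2).integrable_norm_pow (by norm_num)
  have := h.comp_mul_left' (R := (2 * π)⁻¹) (by positivity)
  refine this.congr ?_
  filter_upwards with x
  simp [Psi_eq_fourier]

lemma Psi_deriv {g : ℝ → ℂ} (hg : Integrable g) (hd : Differentiable ℝ g) (hg' : Integrable (deriv g)) (x : ℝ) :
    Psi (deriv g) x = I * x * Psi g x := by
  rw [Psi_eq_fourier, Real.fourier_deriv hg hd hg', Psi_eq_fourier]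
  simp only [smul_eq_mul]
  push_cast
  have : (π : ℂ) ≠ 0 := by norm_cast; positivity
  field_simp

lemma Psi_integrable {g : ℝ → ℂ} (hg : Integrable g) (hg2 : MemLp g 2) (hd : Differentiable ℝ g)
    (hg' : Integrable (deriv g)) (hg2' : MemLp (deriv g) 2) : Integrable (Psi g) := by
  have h1 := plancherel_Psi hg hg2
  have h2 := plancherel_Psi hg' hg2'
  refine ((h1.add h2).add integrable_inv_one_add_sq).mono' (Psi_continuous hg).aestronglyMeasurable ?_
  filter_upwards with x
  simp only [Pi.add_apply, Psi_deriv hg hd hg']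
  rw [norm_mul, norm_mul, Complex.norm_I, Complex.norm_real, one_mul, mul_pow, Real.norm_eq_abs, sq_abs]
  set a := ‖Psi g x‖
  have ha : 0 ≤ a := norm_nonneg _
  have hx : 0 < 1 + x ^ 2 := by positivity
  have : a ^ 2 + x ^ 2 * a ^ 2 + (1 + x ^ 2)⁻¹ - a = (((1 + x ^ 2) * a - 1/2)^2 + 3/4) / (1 + x^2) := by
    field_simp; ring
  have h3 : 0 ≤ (((1 + x ^ 2) * a - 1/2)^2 + 3/4) / (1 + x^2) := by positivity
  linarith

lemma decay_class {u : ℝ → ℂ} {C β : ℝ} (hβ : 1 < β) (hu : AEStronglyMeasurable u)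
    (hb : ∀ t, ‖u t‖ ≤ C * (1 + ‖t‖) ^ (-β)) : Integrable u ∧ MemLp u 2 := by
  have hi : Integrable u := by
    refine ((integrable_one_add_norm (μ := volume) (E := ℝ) (r := β) (by simpa using hβ)).const_mul C).mono' hu ?_
    filter_upwards with t using hb t
  refine ⟨hi, ?_⟩
  rw [memLp_two_iff_integrable_sq_norm hu]
  have hC : ∀ t, ‖u t‖ ≤ |C| := by
    intro t
    refine (hb t).trans ?_
    have h1 : (1 + ‖t‖) ^ (-β) ≤ 1 :=
      Real.rpow_le_one_of_one_le_of_nonpos (by linarith [norm_nonneg t]) (by linarith)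
    have h0 : 0 ≤ (1 + ‖t‖) ^ (-β) := by positivity
    calc C * (1 + ‖t‖) ^ (-β) ≤ |C| * (1 + ‖t‖) ^ (-β) := by gcongr; exact le_abs_self C
      _ ≤ |C| * 1 := by gcongr
      _ = |C| := mul_one _
  refine (hi.norm.const_mul |C|).mono' (hu.norm.pow 2) ?_
  filter_upwards with t
  rw [norm_pow, norm_norm, sq]
  gcongr
  exact hC t

/-- The kernel multiplier. -/
noncomputable def gK (k : ℝ → ℂ) (β : ℝ) (t : ℝ) : ℂ := (k t - 1) * (-(I * t)) ^ ((-β : ℝ) : ℂ)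

lemma norm_negIt (t : ℝ) : ‖-(I * t)‖ = |t| := by simp

lemma rpow_bd {t β : ℝ} (hβ : 0 < β) (ht : 1 ≤ |t|) : |t| ^ (-β) ≤ 2 ^ β * (1 + ‖t‖) ^ (-β) := by
  rw [Real.norm_eq_abs, Real.rpow_neg (by positivity), Real.rpow_neg (by positivity), ← div_eq_mul_inv,
    ← Real.div_rpow (by norm_num) (by positivity), ← Real.inv_rpow (by positivity)]
  apply Real.rpow_le_rpow (by positivity) _ hβ.le
  rw [inv_eq_one_div, div_le_div_iff₀ (by linarith) (by linarith)]
  linarith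

lemma gK_good {k : ℝ → ℂ} {β M M' : ℝ} (hβ : 1 < β) (hk : Differentiable ℝ k)
    (hM : ∀ t, ‖k t‖ ≤ M) (hM' : ∀ t, ‖deriv k t‖ ≤ M') (h1 : ∀ t, |t| ≤ 1 → k t = 1) :
    Integrable (gK k β) ∧ Integrable (Psi (gK k β)) := by
  have hM0 : 0 ≤ M := (norm_nonneg _).trans (hM 0)
  have hM0' : 0 ≤ M' := (norm_nonneg _).trans (hM' 0)
  have hz : ∀ t, |t| < 1 → HasDerivAt (gK k β) 0 t := by
    intro t ht
    refine (hasDerivAt_const t (0 : ℂ)).congr_of_eventuallyEq ?_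
    filter_upwards [(isOpen_lt continuous_abs continuous_const).mem_nhds ht] with s hs
    simp [gK, h1 s (le_of_lt hs)]
  have hnz : ∀ t, 1 ≤ |t| → HasDerivAt (gK k β)
      (deriv k t * (-(I * t)) ^ ((-β : ℝ) : ℂ) +
        (k t - 1) * (((-β : ℝ) : ℂ) * (-(I * t)) ^ (((-β : ℝ) : ℂ) - 1) * (-(I * 1)))) t := by
    intro t ht
    have ht0 : t ≠ 0 := by rintro rfl; simp at ht; linarith
    have hc : HasDerivAt (fun t : ℝ => -(I * (t : ℂ))) (-(I * 1)) t :=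
      ((Complex.ofRealCLM.hasDerivAt (x := t)).const_mul I).neg
    have hs : -(I * (t : ℂ)) ∈ slitPlane := by
      rw [mem_slitPlane_iff]; right; simpa using ht0
    have h2 : HasDerivAt (fun t : ℝ => (-(I * (t : ℂ))) ^ ((-β : ℝ) : ℂ))
      (((-β : ℝ) : ℂ) * (-(I * t)) ^ (((-β : ℝ) : ℂ) - 1) * (-(I * 1))) t := by
      have := (hasDerivAt_id (-(I * (t : ℂ)))).cpow_const (c := ((-β : ℝ) : ℂ)) hs
      have := this.comp t hc
      simpa [Function.comp_def] using this
    exact ((hk t).hasDerivAt.sub_const 1).mul h2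
  have hdiff : Differentiable ℝ (gK k β) := by
    intro t
    rcases lt_or_ge |t| 1 with h | h
    · exact (hz t h).differentiableAt
    · exact (hnz t h).differentiableAt
  have hb1 : ∀ t, ‖gK k β t‖ ≤ ((M + 1) * 2 ^ β) * (1 + ‖t‖) ^ (-β) := by
    intro t
    rcases lt_or_ge |t| 1 with h | h
    · rw [gK, h1 t h.le]; simp; positivity
    · rw [gK, norm_mul, Complex.norm_cpow_real, norm_negIt, mul_assoc]
      gcongr
      · exact (norm_sub_le _ _).trans (by simpa using hM t)
      · exact rpow_bd (by linarith) h
  have hb2 : ∀ t, ‖deriv (gK k β) t‖ ≤ ((M' + (M + 1) * β) * 2 ^ β) * (1 + ‖t‖) ^ (-β) := by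
    intro t
    rcases lt_or_ge |t| 1 with h | h
    · rw [(hz t h).deriv]; simp; positivity
    · rw [(hnz t h).deriv]
      have e : (((-β : ℝ) : ℂ) - 1) = ((-β - 1 : ℝ) : ℂ) := by push_cast; ring
      have h3 : |t| ^ (-β - 1) ≤ |t| ^ (-β) := Real.rpow_le_rpow_of_exponent_le h (by linarith)
      calc _ ≤ M' * |t| ^ (-β) + (M + 1) * (β * |t| ^ (-β)) := by
            refine (norm_add_le _ _).trans ?_
            rw [norm_mul, norm_mul, norm_mul, norm_mul, e, Complex.norm_cpow_real, Complex.norm_cpow_real,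
              norm_negIt, Complex.norm_real]
            simp only [norm_neg, mul_one, Complex.norm_I, Real.norm_eq_abs, abs_of_pos (by linarith : 0 < β)]
            gcongr
            · exact hM' t
            · exact (norm_sub_le _ _).trans (by simpa using hM t)
        _ = (M' + (M + 1) * β) * |t| ^ (-β) := by ring
        _ ≤ _ := by
          rw [mul_assoc]; gcongr; exact rpow_bd (by linarith) h
  obtain ⟨a1, a2⟩ := decay_class hβ hdiff.continuous.aestronglyMeasurable hb1
  obtain ⟨a3, a4⟩ := decay_class hβ (aestronglyMeasurable_deriv _ _) hb2
  exact ⟨a1, Psi_integrable a1 a2 hdiff a3 a4⟩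

lemma k_good {K : ℝ → ℂ} (hK : Integrable K) (hK' : Integrable fun x : ℝ => x • K x) :
    Differentiable ℝ (fun t => Psi K (-t)) ∧ ∃ M, ∀ t, ‖deriv (fun t => Psi K (-t)) t‖ ≤ M := by
  have hd : ∀ t, HasDerivAt (fun t => Psi K (-t))
      (((2 * π)⁻¹ * (-1) : ℝ) • 𝓕 (fun x : ℝ ↦ (-2 * π * I * x) • K x) ((2 * π)⁻¹ * (-t))) t := by
    intro t
    have h1 := Real.hasDerivAt_fourier hK hK' ((2 * π)⁻¹ * (-t))
    have h2 : HasDerivAt (fun t : ℝ => (2 * π)⁻¹ * (-t)) ((2 * π)⁻¹ * (-1)) t :=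
      ((hasDerivAt_id t).neg).const_mul _
    have := HasDerivAt.scomp t h1 h2
    simpa only [Function.comp_def, ← Psi_eq_fourier] using this
  refine ⟨fun t => (hd t).differentiableAt, ?_⟩
  refine ⟨‖((2 * π)⁻¹ * (-1) : ℝ)‖ * ∫ x, ‖(fun x : ℝ ↦ (-2 * π * I * x) • K x) x‖, fun t => ?_⟩
  rw [(hd t).deriv, norm_smul, fourier_eq_Psi]
  gcongr
  exact Psi_norm_le _ _

lemma gK_scale {k : ℝ → ℂ} {β h : ℝ} (hβ : 0 < β) (hh : 0 < h) (t : ℝ) :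
    gK (fun t => k (h * t)) β t = ((h ^ β : ℝ) : ℂ) * gK k β (h * t) := by
  unfold gK
  have e : -(I * ((h * t : ℝ) : ℂ)) = (h : ℂ) * (-(I * t)) := by push_cast; ring
  have hh' : (h : ℂ) ≠ 0 := by exact_mod_cast hh.ne'
  have key : (-(I * (t : ℂ))) ^ ((-β : ℝ) : ℂ) =
      ((h ^ β : ℝ) : ℂ) * ((h : ℂ) * (-(I * t))) ^ ((-β : ℝ) : ℂ) := by
    by_cases ht : t = 0
    · have : ((-β : ℝ) : ℂ) ≠ 0 := by exact_mod_cast (by linarith : -β < 0).ne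
      subst ht; simp only [ofReal_zero, mul_zero, neg_zero]
      rw [Complex.zero_cpow this]; simp
    · have hc : -(I * (t : ℂ)) ≠ 0 := by simpa using ht
      rw [Complex.ofReal_cpow hh.le, Complex.cpow_def_of_ne_zero hh', Complex.cpow_def_of_ne_zero hc,
        Complex.cpow_def_of_ne_zero (mul_ne_zero hh' hc), Complex.log_ofReal_mul hh hc, ← Complex.exp_add,
        Complex.ofReal_log hh.le]
      congr 1; push_cast; ring
  rw [e, key]; ring

lemma Psi_scale {k : ℝ → ℂ} {β h : ℝ} (hβ : 0 < β) (hh : 0 < h) (x : ℝ) :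
    Psi (gK (fun t => k (h * t)) β) x = ((h ^ (β - 1) : ℝ) : ℂ) * Psi (gK k β) (h⁻¹ * x) := by
  unfold Psi
  have := Measure.integral_comp_mul_left
    (fun t : ℝ => Complex.exp (-(Complex.I * t * (h⁻¹ * x : ℝ))) * gK k β t) h
  rw [abs_of_pos (by positivity)] at this
  calc _ = ((h ^ β : ℝ) : ℂ) * ∫ t : ℝ, Complex.exp (-(Complex.I * (h * t : ℝ) * (h⁻¹ * x : ℝ))) * gK k β (h * t) := by
        rw [← integral_const_mul]
        congr 1; ext t
        rw [gK_scale hβ hh]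
        have : -(Complex.I * (h * t : ℝ) * (h⁻¹ * x : ℝ)) = -(I * t * x) := by
          have hh' : (h : ℂ) ≠ 0 := by exact_mod_cast hh.ne'
          push_cast; field_simp
        rw [this]; ring
    _ = _ := by
        rw [this, Complex.real_smul, ← mul_assoc, ← Complex.ofReal_mul, Real.rpow_sub_one hh.ne', div_eq_mul_inv]

lemma gK_scaled_good {k : ℝ → ℂ} {β h : ℝ} (hβ : 0 < β) (hh : 0 < h) (h1 : Integrable (gK k β))
    (h2 : Integrable (Psi (gK k β))) :
    Integrable (gK (fun t => k (h * t)) β) ∧ Integrable (Psi (gK (fun t => k (h * t)) β)) ∧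
    ∫ x, ‖Psi (gK (fun t => k (h * t)) β) x‖ = h ^ β * ∫ x, ‖Psi (gK k β) x‖ := by
  refine ⟨?_, ?_, ?_⟩
  · refine ((h1.comp_mul_left' hh.ne').const_mul ((h ^ β : ℝ) : ℂ)).congr ?_
    filter_upwards with t
    rw [gK_scale hβ hh]
  · refine ((h2.comp_mul_left' (inv_pos.2 hh).ne').const_mul ((h ^ (β - 1) : ℝ) : ℂ)).congr ?_
    filter_upwards with t
    rw [Psi_scale hβ hh]
  · simp_rw [Psi_scale hβ hh, norm_mul]
    rw [integral_const_mul, Measure.integral_comp_mul_left (fun x => ‖Psi (gK k β) x‖), inv_inv, abs_of_pos hh,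
      smul_eq_mul, ← mul_assoc, Complex.norm_real, Real.norm_of_nonneg (by positivity), Real.rpow_sub_one hh.ne']
    field_simp

lemma fhat_integrable {α : ℝ} {p : ℝ → ℂ} {M : ℝ} (hα : 0 < α) (hc : Continuous p) (hM : ∀ t, ‖p t‖ ≤ M)
    (hi : Integrable fun t => |t| ^ α * ‖p t‖) : Integrable p := by
  have h1 : Integrable (fun t => (Icc (-1) 1).indicator (fun _ : ℝ => M) t) :=
    IntegrableOn.integrable_indicator (integrable_const M) measurableSet_Icc
  refine (h1.add hi).mono' hc.aestronglyMeasurable ?_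
  filter_upwards with t
  simp only [Pi.add_apply]
  by_cases h : t ∈ Icc (-1 : ℝ) 1
  · rw [indicator_of_mem h]
    have : 0 ≤ |t| ^ α * ‖p t‖ := by positivity
    linarith [hM t]
  · rw [indicator_of_notMem h, zero_add]
    have : 1 ≤ |t| := by
      by_contra h'
      exact h (abs_le.1 (not_le.1 h').le)
    exact le_mul_of_one_le_left (norm_nonneg _) (Real.one_le_rpow this hα.le)

lemma kern_bound (t z : ℝ) : ‖(Complex.exp (I * t * z) - 1) / (-(I * t))‖ ≤ |z| := by
  by_cases ht : t = 0
  · subst ht; simp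
  have h := Real.norm_exp_I_mul_ofReal_sub_one_le (x := t * z)
  rw [norm_div, norm_negIt, div_le_iff₀ (abs_pos.2 ht)]
  rw [Real.norm_eq_abs, abs_mul] at h
  push_cast at h
  rw [← mul_assoc] at h
  linarith

/-- increments of the distribution function -/
lemma F_incr {f : ℝ → ℝ} (hf : Integrable f) {p : ℝ → ℂ} (hp : p = fun t => Psi (fun x => (f x : ℂ)) (-t))
    (hpi : Integrable p) {F : ℝ → ℝ} (hF : ∀ x, F x = ∫ t in Set.Iic x, f t) (x z : ℝ) :
    ((F (x - z) - F x : ℝ) : ℂ) = (1 / (2 * π)) *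
      ∫ t : ℝ, Complex.exp (-(I * t * x)) * p t * ((Complex.exp (I * t * z) - 1) / (-(I * t))) := by
  have hfc : Integrable (fun x => (f x : ℂ)) := hf.ofReal
  have hpi' : Integrable (Psi (fun x => (f x : ℂ))) := by
    have := hpi.comp_neg
    simpa [hp] using this
  have hae : ∀ᵐ y, Psi p y = 2 * π * f y := by
    filter_upwards [Psi_Psi_ae hfc hpi'] with y hy
    rw [← hy, hp]
    unfold Psi
    rw [← integral_neg_eq_self]
    congr 1; ext t
    simp
  have h1 : ((F (x - z) - F x : ℝ) : ℂ) = ∫ y in x..(x - z), (1 / (2 * π) : ℂ) * Psi p y := by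
    rw [hF, hF, intervalIntegral.integral_Iic_sub_Iic hf.integrableOn hf.integrableOn,
      ← intervalIntegral.integral_ofReal]
    apply intervalIntegral.integral_congr_ae
    filter_upwards [hae] with y hy _
    rw [hy]
    have : (π : ℂ) ≠ 0 := by norm_cast; positivity
    field_simp
  rw [h1, intervalIntegral.integral_const_mul]
  congr 1
  unfold Psi
  rw [intervalIntegral_integral_swap]
  · apply integral_congr_ae
    have : ∀ᵐ t : ℝ, t ≠ 0 := by simp [ae_iff]
    filter_upwards [this] with t ht
    have hc : -(I * (t : ℂ)) ≠ 0 := by simpa using ht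
    rw [intervalIntegral.integral_mul_const]
    have e : ∀ y : ℝ, Complex.exp (-(I * t * y)) = Complex.exp (-(I * t) * y) := by
      intro y; congr 1; ring
    simp_rw [e]
    rw [integral_exp_mul_complex hc]
    have e2 : Complex.exp (-(I * t) * (x - z : ℝ)) = Complex.exp (-(I * t) * x) * Complex.exp (I * t * z) := by
      rw [← Complex.exp_add]; congr 1; push_cast; ring
    rw [e2]
    ring
  · have : Integrable (fun q : ℝ × ℝ => (1 : ℝ) * ‖p q.2‖) ((volume.restrict (Set.uIoc x (x - z))).prod volume) :=
      Integrable.mul_prod (f := fun _ => (1 : ℝ)) (g := fun t => ‖p t‖) (by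
        have : IsFiniteMeasure (volume.restrict (Set.uIoc x (x - z))) := by
          rw [uIoc]; infer_instance
        exact integrable_const _) hpi.norm
    refine this.mono' ?_ ?_
    · exact (by fun_prop : Continuous fun q : ℝ × ℝ => Complex.exp (-(I * q.2 * q.1))).aestronglyMeasurable.mul
        hpi.1.comp_snd
    · filter_upwards with q
      simp only [Function.uncurry, norm_mul]
      rw [Complex.norm_exp]; simp

/-- Fourier representation of the bias. -/
lemma bias_repr {f : ℝ → ℝ} (hf : Integrable f) {p : ℝ → ℂ} (hp : p = fun t => Psi (fun x => (f x : ℂ)) (-t))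
    (hpi : Integrable p) {F : ℝ → ℝ} (hF : ∀ x, F x = ∫ t in Set.Iic x, f t)
    {W : ℝ → ℝ} (hW : Integrable W) (hW1 : ∫ z, W z = 1) (hWm : Integrable fun z => |z| * |W z|)
    (x : ℝ) :
    (((∫ z, F (x - z) * W z) - F x : ℝ) : ℂ) = (1 / (2 * π)) *
      Psi (fun t => p t * ((Psi (fun z => (W z : ℂ)) (-t) - 1) / (-(I * t)))) x := by
  have hFm : Continuous F := by
    have : F = fun x => ∫ t in Set.Iic x, f t := funext hF
    rw [this]
    have h0 : ∀ x, ∫ t in Set.Iic x, f t = (∫ t in Set.Iic 0, f t) + ∫ t in (0:ℝ)..x, f t := by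
      intro x
      rw [← intervalIntegral.integral_Iic_sub_Iic hf.integrableOn hf.integrableOn]; ring
    rw [funext h0]
    exact continuous_const.add (intervalIntegral.continuous_primitive (fun a b => hf.intervalIntegrable) 0)
  have hFb : ∀ x, ‖F x‖ ≤ ∫ t, ‖f t‖ := by
    intro x
    rw [hF]
    refine (norm_integral_le_integral_norm _).trans ?_
    exact setIntegral_le_integral hf.norm (by filter_upwards with t using norm_nonneg _)
  have hFW : Integrable fun z => F (x - z) * W z :=
    hW.bdd_mul (c := ∫ t, ‖f t‖) (by fun_prop) (by filter_upwards with z using hFb _)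
  have h1 : (∫ z, F (x - z) * W z) - F x = ∫ z, (F (x - z) - F x) * W z := by
    simp_rw [sub_mul]
    rw [integral_sub hFW (hW.const_mul _), integral_const_mul, hW1, mul_one]
  rw [h1, ← integral_complex_ofReal]
  have h2 : ∀ z, (((F (x - z) - F x) * W z : ℝ) : ℂ) = (1 / (2 * π)) *
      ∫ t : ℝ, Complex.exp (-(I * t * x)) * p t * ((Complex.exp (I * t * z) - 1) / (-(I * t))) * W z := by
    intro z
    rw [Complex.ofReal_mul, F_incr hf hp hpi hF, mul_assoc, integral_mul_const]
  simp_rw [h2]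
  rw [integral_const_mul]
  congr 1
  rw [integral_integral_swap]
  · unfold Psi
    congr 1; ext t
    have h3 : ∀ z : ℝ, Complex.exp (-(I * t * x)) * p t * ((Complex.exp (I * t * z) - 1) / (-(I * t))) * W z
      = (Complex.exp (-(I * t * x)) * p t / (-(I * t))) * (Complex.exp (-(I * z * (-t : ℝ))) * W z - W z) := by
      intro z
      have : -(I * z * (-t : ℝ)) = I * t * z := by push_cast; ring
      rw [this]; ring
    simp_rw [h3]
    rw [integral_const_mul, integral_sub, integral_complex_ofReal, hW1]
    · push_cast; ring
    · refine hW.ofReal.bdd_mul (c := 1) (by fun_prop) ?_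
      filter_upwards with z
      rw [Complex.norm_exp]; simp
    · exact hW.ofReal
  · have := hWm.mul_prod hpi.norm
    refine this.mono' ?_ ?_
    · have m1 : Measurable fun q : ℝ × ℝ => ((Complex.exp (I * q.2 * q.1) - 1) / (-(I * q.2))) := by fun_prop
      have m2 : Continuous fun q : ℝ × ℝ => Complex.exp (-(I * q.2 * x)) := by fun_prop
      exact ((m2.aestronglyMeasurable.mul hpi.1.comp_snd).mul m1.aestronglyMeasurable).mul
        (hW.ofReal (𝕜 := ℂ)).1.comp_fst
    · filter_upwards with q
      simp only [Function.uncurry, norm_mul]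
      have e1 : ‖Complex.exp (-(I * q.2 * x))‖ = 1 := by rw [Complex.norm_exp]; simp
      rw [e1, one_mul, Complex.norm_real, Real.norm_eq_abs]
      calc _ ≤ ‖p q.2‖ * |q.1| * |W q.1| := by
            gcongr; exact kern_bound _ _
        _ = _ := by ring

/-- Multiplication of the transform as convolution. -/
lemma conv_repr {φ g D : ℝ → ℂ} (hφ : Integrable φ) (hg : Integrable g) (hD : Integrable D)
    (hDe : D = fun x => (1 / (2 * π) : ℂ) * Psi φ x) (x : ℝ) :
    Psi (fun t => φ t * g t) x = ∫ y, D y * Psi g (x - y) := by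
  have hP : Integrable (Psi φ) := by
    refine (hD.const_mul (2 * π : ℂ)).congr ?_
    filter_upwards with y
    rw [hDe]
    have : (π : ℂ) ≠ 0 := by norm_cast; positivity
    field_simp
  have hae : ∀ᵐ t : ℝ, ∫ y : ℝ, Complex.exp (I * t * y) * D y = φ t := by
    filter_upwards [Psi_Psi_ae hφ hP] with t ht
    have : ∫ y : ℝ, Complex.exp (I * t * y) * D y = (1 / (2 * π) : ℂ) * Psi (Psi φ) (-t) := by
      conv_rhs => unfold Psi
      rw [← integral_const_mul]
      congr 1; ext y
      have : -(I * y * (-t : ℝ)) = I * t * y := by push_cast; ring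
      rw [this, hDe]; unfold Psi; ring
    rw [this, ht]
    have : (π : ℂ) ≠ 0 := by norm_cast; positivity
    field_simp
  have h1 : ∀ y, D y * Psi g (x - y) = ∫ t : ℝ, D y * (Complex.exp (-(I * t * (x - y : ℝ))) * g t) := by
    intro y; rw [Psi, integral_const_mul]
  simp_rw [h1]
  rw [integral_integral_swap]
  · unfold Psi
    apply integral_congr_ae
    filter_upwards [hae] with t ht
    rw [← ht]
    have : ∀ y : ℝ, D y * (Complex.exp (-(I * t * (x - y : ℝ))) * g t) =
        (Complex.exp (-(I * t * x)) * g t) * (Complex.exp (I * t * y) * D y) := by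
      intro y
      have : Complex.exp (-(I * t * (x - y : ℝ))) = Complex.exp (-(I * t * x)) * Complex.exp (I * t * y) := by
        rw [← Complex.exp_add]; congr 1; push_cast; ring
      rw [this]; ring
    simp_rw [this]
    rw [integral_const_mul]; ring
  · refine (hD.norm.mul_prod hg.norm).mono' ?_ ?_
    · exact hD.1.comp_fst.mul ((by fun_prop : Continuous fun q : ℝ × ℝ =>
        Complex.exp (-(I * q.2 * (x - q.1 : ℝ)))).aestronglyMeasurable.mul hg.1.comp_snd)
    · filter_upwards with q
      simp only [Function.uncurry, norm_mul]
      have e1 : ‖Complex.exp (-(I * q.2 * (x - q.1 : ℝ)))‖ = 1 := by rw [Complex.norm_exp]; simp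
      rw [e1, one_mul]

lemma young {D P : ℝ → ℂ} (hD : Integrable D) (hP : Integrable P) :
    ∫ x, ‖∫ y, D y * P (x - y)‖ ≤ (∫ y, ‖D y‖) * ∫ x, ‖P x‖ := by
  have h1 := integral_convolution (ContinuousLinearMap.mul ℝ ℝ) (μ := volume) (ν := volume) hD.norm hP.norm
  have h2 := Integrable.integrable_convolution (ContinuousLinearMap.mul ℝ ℝ) (μ := volume) hD.norm hP.norm
  simp only [ContinuousLinearMap.mul_apply'] at h1
  rw [← h1]
  apply integral_mono_of_nonneg (by filter_upwards with x using norm_nonneg _) h2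
  filter_upwards with x
  rw [convolution_def]
  refine (norm_integral_le_integral_norm _).trans (le_of_eq ?_)
  congr 1; ext y; simp

/-- Bias bound under Sobolev-type regularity: if the density `f₀X` satisfies
`∫ |t|^α |f̂₀X(t)| dt < ∞` and its fractional derivative
`D^α f₀X(x) = (2π)⁻¹ ∫ e^{−itx} (−it)^α f̂₀X(t) dt` is in `L¹(ℝ)`, and `K` is a symmetric
`L¹ ∩ L²` kernel with `∫|z||K(z)|dz < ∞`, integrable Fourier transform equal to `1` on
`[−1,1]`, then the distribution function `F₀X` of `f₀X` satisfies
`∫ |(F₀X ∗ K_h)(x) − F₀X(x)| dx ≤ C h^{α+1}` for all small `h > 0`. -/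
theorem stmt19 (α : ℝ) (hα : 0 < α)
    (f₀X : ℝ → ℝ) (hmeas : Measurable f₀X) (hnn : ∀ x, 0 ≤ f₀X x)
    (hint : Integrable f₀X) (hone : ∫ x, f₀X x = 1)
    (hFTmom : Integrable (fun t : ℝ =>
      |t| ^ α * ‖∫ x : ℝ, Complex.exp (Complex.I * t * x) * f₀X x‖))
    (hDα : Integrable (fun x : ℝ =>
      (1 / (2 * Real.pi) : ℂ) * ∫ t : ℝ, Complex.exp (-(Complex.I * t * x)) *
        ((-(Complex.I * t)) ^ (α : ℂ)) *
        (∫ y : ℝ, Complex.exp (Complex.I * t * y) * f₀X y)))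
    (K : ℝ → ℝ) (hKmeas : Measurable K) (hKint : Integrable K)
    (hKsq : Integrable (fun z => (K z) ^ 2)) (hKsymm : ∀ z, K (-z) = K z)
    (hKmom : Integrable (fun z => |z| * |K z|))
    (hKhatInt : Integrable (fun t : ℝ => ∫ z : ℝ, Complex.exp (Complex.I * t * z) * K z))
    (hKhatOne : ∀ t : ℝ, |t| ≤ 1 → (∫ z : ℝ, Complex.exp (Complex.I * t * z) * K z) = 1)
    (F : ℝ → ℝ) (hF : ∀ x, F x = ∫ t in Set.Iic x, f₀X t) :
    ∃ C : ℝ, 0 < C ∧ ∃ h₀ : ℝ, 0 < h₀ ∧ ∀ h : ℝ, 0 < h → h < h₀ →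
      (∫ x : ℝ, |(∫ z : ℝ, F (x - z) * ((1 / h) * K (z / h))) - F x|) ≤
        C * h ^ (α + 1) := by
  -- Fourier transforms in the `Psi` notation
  have hPhi : ∀ (u : ℝ → ℝ) (t : ℝ),
      ∫ x : ℝ, Complex.exp (Complex.I * t * x) * u x = Psi (fun x => (u x : ℂ)) (-t) := by
    intro u t
    unfold Psi
    congr 1; ext x; congr 2; push_cast; ring
  simp_rw [hPhi] at hFTmom hDα hKhatOne
  obtain ⟨p, hp⟩ : ∃ p : ℝ → ℂ, p = fun t => Psi (fun x => (f₀X x : ℂ)) (-t) := ⟨_, rfl⟩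
  obtain ⟨k, hk⟩ : ∃ k : ℝ → ℂ, k = fun t => Psi (fun x => (K x : ℂ)) (-t) := ⟨_, rfl⟩
  have hpt : ∀ t, Psi (fun x => (f₀X x : ℂ)) (-t) = p t := fun t => by rw [hp]
  have hkt : ∀ t, Psi (fun x => (K x : ℂ)) (-t) = k t := fun t => by rw [hk]
  simp_rw [hpt] at hFTmom hDα
  simp_rw [hkt] at hKhatOne
  have hpc : Continuous p := by
    rw [hp]; exact (Psi_continuous hint.ofReal).comp continuous_neg
  have hpi : Integrable p :=
    fhat_integrable hα hpc (fun t => by rw [hp]; exact Psi_norm_le _ _) hFTmom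
  -- the transform of the fractional derivative
  obtain ⟨φ, hφ⟩ : ∃ φ : ℝ → ℂ, φ = fun t : ℝ => (-(I * t)) ^ (α : ℂ) * p t := ⟨_, rfl⟩
  have hφi : Integrable φ := by
    rw [hφ]
    refine hFTmom.mono' ?_ ?_
    · have : Measurable fun t : ℝ => (-(I * (t : ℂ))) ^ (α : ℂ) := by fun_prop
      exact this.aestronglyMeasurable.mul hpc.aestronglyMeasurable
    · filter_upwards with t
      rw [norm_mul, Complex.norm_cpow_real, norm_negIt]
  obtain ⟨D, hD⟩ : ∃ D : ℝ → ℂ, D = fun x => (1 / (2 * π) : ℂ) * Psi φ x := ⟨_, rfl⟩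
  have hDi : Integrable D := by
    rw [hD]
    refine hDα.congr ?_
    filter_upwards with x
    unfold Psi
    congr 2; ext t; rw [hφ]; ring
  -- the kernel
  have hKm : Integrable fun x : ℝ => x • (K x : ℂ) := by
    refine hKmom.mono' ?_ ?_
    · exact aestronglyMeasurable_id.smul hKint.ofReal.1
    · filter_upwards with x; simp
  obtain ⟨hkd, M', hM'⟩ := k_good (K := fun x => (K x : ℂ)) hKint.ofReal hKm
  rw [← hk] at hkd hM'
  obtain ⟨hg, hG⟩ := gK_good (k := k) (β := α + 1) (by linarith) hkd
    (fun t => by rw [hk]; exact Psi_norm_le _ _) hM' hKhatOne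
  refine ⟨1 / (2 * π) * ((∫ y, ‖D y‖) * ∫ x, ‖Psi (gK k (α + 1)) x‖) + 1, by positivity, 1, one_pos, ?_⟩
  intro h hh _
  obtain ⟨hgi, hGi, hGn⟩ := gK_scaled_good (k := k) (β := α + 1) (by linarith) hh hg hG
  -- the rescaled kernel
  obtain ⟨W, hW⟩ : ∃ W : ℝ → ℝ, W = fun z => (1 / h) * K (z / h) := ⟨_, rfl⟩
  have hWi : Integrable W := by rw [hW]; exact (hKint.comp_div hh.ne').const_mul _
  have hWm : Integrable fun z => |z| * |W z| := by
    refine (hKmom.comp_div hh.ne').congr ?_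
    filter_upwards with z
    rw [hW]
    simp only [abs_mul, abs_div, abs_of_pos hh, abs_one]
    field_simp
  have hWhat : ∀ t, Psi (fun z => (W z : ℂ)) (-t) = k (h * t) := by
    intro t
    rw [← hkt]
    unfold Psi
    have := Measure.integral_comp_div (fun z : ℝ => Complex.exp (-(I * z * (-(h * t) : ℝ))) * K z) h
    rw [abs_of_pos hh] at this
    have hh' : (h : ℂ) ≠ 0 := by exact_mod_cast hh.ne'
    calc _ = (1 / h : ℂ) * ∫ z : ℝ, Complex.exp (-(I * (z / h : ℝ) * (-(h * t) : ℝ))) * K (z / h) := by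
          rw [← integral_const_mul]
          congr 1; ext z
          have : -(I * (z / h : ℝ) * (-(h * t) : ℝ)) = -(I * z * (-t : ℝ)) := by
            push_cast; field_simp
          rw [this, hW]; push_cast; ring
      _ = _ := by
          rw [this, Complex.real_smul, ← mul_assoc, one_div, inv_mul_cancel₀ hh', one_mul]
  have hW1 : ∫ z, W z = 1 := by
    have h0 := hWhat 0
    rw [mul_zero, hKhatOne 0 (by simp)] at h0
    unfold Psi at h0
    simp only [neg_zero, ofReal_zero, mul_zero, Complex.exp_zero, one_mul] at h0
    rw [integral_complex_ofReal] at h0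
    exact_mod_cast h0
  have hbias : ∀ x, |(∫ z : ℝ, F (x - z) * ((1 / h) * K (z / h))) - F x| =
      1 / (2 * π) * ‖∫ y, D y * Psi (gK (fun t => k (h * t)) (α + 1)) (x - y)‖ := by
    intro x
    have e1 := bias_repr hint hp hpi hF hWi hW1 hWm x
    rw [← Real.norm_eq_abs, ← Complex.norm_real]
    have e2 : (∫ z : ℝ, F (x - z) * ((1 / h) * K (z / h))) = ∫ z, F (x - z) * W z := by rw [hW]
    rw [e2, e1, norm_mul, ← conv_repr hφi hgi hDi hD]
    congr 1
    · rw [norm_div, norm_mul]; simp [abs_of_pos Real.pi_pos]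
    · congr 2
      ext t
      rw [hWhat, hφ]
      unfold gK
      by_cases ht : t = 0
      · subst ht
        simp only [mul_zero]
        rw [hKhatOne 0 (by simp)]; simp
      · have hc : -(I * (t : ℂ)) ≠ 0 := by simpa using ht
        have : (-(I * (t : ℂ))) ^ (α : ℂ) * (-(I * (t : ℂ))) ^ ((-(α + 1) : ℝ) : ℂ) = (-(I * (t : ℂ)))⁻¹ := by
          rw [← Complex.cpow_add _ _ hc, ← Complex.cpow_neg_one]
          congr 1; push_cast; ring
        rw [div_eq_mul_inv, ← this]; ring
  simp_rw [hbias]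
  rw [integral_const_mul]
  have hY := young hDi hGi
  rw [hGn] at hY
  have hpow : 0 < h ^ (α + 1) := by positivity
  calc _ ≤ 1 / (2 * π) * ((∫ y, ‖D y‖) * (h ^ (α + 1) * ∫ x, ‖Psi (gK k (α + 1)) x‖)) := by gcongr
    _ ≤ _ := by nlinarith
end
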